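/- Let X ⊂ P^4 be an integral normal nondegenerate surface of degree d which is a cone with vertex v, and let g be the arithmetic genus of a general hyperplane section avoiding v. Then for a general q ∈ P^4 the entry locus Γ_q(X) is the union of (d−1)(d−2) − 2g lines through v; in particular Γ_q(X) is reducible (X is of type II). -/

import Mathlib

open MvPolynomial

noncomputable section

namespace EL

variable {k : Type} [Field k] {n : ℕ}

/-- Projective space of (vector) dimension `n` over `k`. -/
abbrev PS (k : Type) [Field k] (n : ℕ) : Type := Projectivization k (Fin n → k)

/-- Projective vanishing set of a polynomial (intended to be homogeneous). -/
def V0 (f : MvPolynomial (Fin n) k) : Set (PS k n) :=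
  {p | ∀ (v : Fin n → k) (hv : v ≠ 0), Projectivization.mk k v hv = p → eval v f = 0}

/-- The Zariski topology on projective space, generated by complements of vanishing
sets of homogeneous polynomials. -/
instance : TopologicalSpace (PS k n) :=
  TopologicalSpace.generateFrom
    {U | ∃ (d : ℕ) (f : MvPolynomial (Fin n) k), f.IsHomogeneous d ∧ U = (V0 f)ᶜ}

/-- The linear span (as a submodule of the cone) of a set of projective points. -/
def pspan (S : Set (PS k n)) : Submodule k (Fin n → k) := ⨆ p ∈ S, p.submodule

/-- The projective linear subspace associated to a submodule. -/
def linSet (W : Submodule k (Fin n → k)) : Set (PS k n) := {p | p.submodule ≤ W}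

/-- `q` lies in the projective span of `S`. -/
def memSpan (q : PS k n) (S : Set (PS k n)) : Prop := q.submodule ≤ pspan S

/-- The projective dimension of the span of `S`. -/
def spanDim (S : Set (PS k n)) : ℕ := Module.finrank k ↥(pspan S) - 1

/-- `S` is nondegenerate (spans the ambient projective space). -/
def Nondeg (S : Set (PS k n)) : Prop := pspan S = ⊤

/-- `S` is a projective linear subspace of projective dimension `d`. -/
def IsLin (S : Set (PS k n)) (d : ℕ) : Prop :=
  ∃ W : Submodule k (Fin n → k), Module.finrank k ↥W = d + 1 ∧ S = linSet W

/-- Dimension of a subset, as topological Krull dimension. -/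
def pdim (S : Set (PS k n)) : WithBot ℕ∞ := topologicalKrullDim ↥S

/-- An integral (sub)variety: an irreducible Zariski-closed set. -/
def IsVariety (S : Set (PS k n)) : Prop := IsClosed S ∧ IsIrreducible S

/-- A property holds for a general point of projective space. -/
def Generic (P : PS k n → Prop) : Prop :=
  ∃ U : Set (PS k n), IsOpen U ∧ Dense U ∧ ∀ q ∈ U, P q

/-- A property holds for a general point of the set `S`. -/
def GenericIn (S : Set (PS k n)) (P : PS k n → Prop) : Prop :=
  ∃ U : Set (PS k n), IsOpen U ∧ S ⊆ closure (S ∩ U) ∧ ∀ q ∈ S ∩ U, P q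

/-- A property holds for a general tuple of points of projective space. -/
def GenericP {ι : Type} (P : (ι → PS k n) → Prop) : Prop :=
  ∃ U : Set (ι → PS k n), IsOpen U ∧ Dense U ∧ ∀ z ∈ U, P z

/-- `q` is spanned by some `s` points of `X`. -/
def hasDecomp (X : Set (PS k n)) (q : PS k n) (s : ℕ) : Prop :=
  ∃ A : Finset (PS k n), ↑A ⊆ X ∧ A.card = s ∧ memSpan q ↑A

/-- The `X`-rank of a point `q`. -/
def rk (X : Set (PS k n)) (q : PS k n) : ℕ := sInf {s | hasDecomp X q s}

/-- `A` irredundantly spans `q`. -/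
def Irredundant (q : PS k n) (A : Finset (PS k n)) : Prop :=
  memSpan q ↑A ∧ ∀ B : Finset (PS k n), B ⊂ A → ¬ memSpan q ↑B

/-- The set `𝒮(X,q)` of minimal irredundant decompositions of `q` by points of `X`. -/
def decomps (X : Set (PS k n)) (q : PS k n) : Set (Finset (PS k n)) :=
  {A | ↑A ⊆ X ∧ A.card = rk X q ∧ Irredundant q A}

/-- The entry locus of `q` with respect to `X`. -/
def entryLocus (X : Set (PS k n)) (q : PS k n) : Set (PS k n) :=
  closure (⋃ A ∈ decomps X q, (↑A : Set (PS k n)))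

/-- The `s`-th secant variety of `X`. -/
def secant (X : Set (PS k n)) (s : ℕ) : Set (PS k n) :=
  closure {q | hasDecomp X q s}

/-- The generic `X`-rank: least `s` whose secant fills the span of `X`. -/
def rgen (X : Set (PS k n)) : ℕ := sInf {s | secant X s = linSet (pspan X)}

/-- Type I: the general entry locus is irreducible. -/
def TypeI (X : Set (PS k n)) : Prop := Generic (fun q => IsIrreducible (entryLocus X q))

/-- Type II: the general entry locus is reducible. -/
def TypeII (X : Set (PS k n)) : Prop := Generic (fun q => ¬ IsIrreducible (entryLocus X q))

/-- Type A: the entry locus does not change at a general point of its span. -/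
def TypeA (X : Set (PS k n)) : Prop :=
  Generic (fun q => GenericIn (linSet (pspan (entryLocus X q)))
    (fun o => entryLocus X o = entryLocus X q))

/-- `S` (of dimension `m`) has degree `d`: `d` is the largest finite number of points cut
on `S` by a linear subspace of complementary dimension. -/
def HasDegree (S : Set (PS k n)) (m d : ℕ) : Prop :=
  IsGreatest {t | ∃ L : Set (PS k n), IsLin L (n - 1 - m) ∧ (S ∩ L).Finite ∧
    (S ∩ L).ncard = t} d

/-- All secant varieties of `Y` (of dimension `m`) have the expected dimension. -/
def NonDefective (Y : Set (PS k n)) (m : ℕ) : Prop :=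
  ∀ s : ℕ, 1 ≤ s →
    pdim (secant Y s) = ((min ((m+1)*s - 1) (spanDim Y) : ℕ) : WithBot ℕ∞)

/-- `π_o(T) ⊆ π_o(Y)`: every point of `T` (other than `o`) is collinear with `o`
and a point of `Y`. -/
def projLE (o : PS k n) (T Y : Set (PS k n)) : Prop :=
  ∀ t ∈ T, t ≠ o → ∃ y ∈ Y, t.submodule ≤ o.submodule ⊔ y.submodule

/-- A Segre point of the pair `(Y,T)`: projection from `o` maps `Y` and `T`
onto the same set. -/
def SegrePtPair (Y T : Set (PS k n)) (o : PS k n) : Prop :=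
  o ∉ Y ∪ T ∧ projLE o Y T ∧ projLE o T Y

/-- A Segre point of `Y`: the projection from `o` is non-birational on `Y`
(it is not generically injective). -/
def SegrePt (Y : Set (PS k n)) (o : PS k n) : Prop :=
  o ∉ Y ∧ ¬ GenericIn Y (fun y => ∀ y' ∈ Y, y'.submodule ≤ o.submodule ⊔ y.submodule → y' = y)

/-- The Segre locus of `Y`. -/
def segreLocus (Y : Set (PS k n)) : Set (PS k n) := closure {o | SegrePt Y o}

/-- `X` is a cone with vertex `v`. -/
def IsCone (X : Set (PS k n)) (v : PS k n) : Prop :=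
  ∀ p ∈ X, ∀ q : PS k n, q.submodule ≤ v.submodule ⊔ p.submodule → q ∈ X

/-- The homogeneous polynomials vanishing on `X`. -/
def homogCut (X : Set (PS k n)) : Set (MvPolynomial (Fin n) k) :=
  {f | (∃ d, f.IsHomogeneous d) ∧ X ⊆ V0 f}

/-- The span of the gradients at `p` of homogeneous polynomials vanishing on `X`. -/
def gradSpan (X : Set (PS k n)) (p : PS k n) : Submodule k (Fin n → k) :=
  Submodule.span k ((fun f => fun i => eval p.rep (pderiv i f)) '' homogCut X)

/-- Smoothness at a point of an `m`-dimensional subvariety (Jacobian criterion). -/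
def IsSmoothPt (X : Set (PS k n)) (m : ℕ) (p : PS k n) : Prop :=
  Module.finrank k ↥(gradSpan X p) = n - (m + 1)

/-- `X` (of dimension `m`) has only isolated singularities. -/
def IsolatedSings (X : Set (PS k n)) (m : ℕ) : Prop :=
  {p ∈ X | ¬ IsSmoothPt X m p}.Finite

/-- `X` (of dimension `m`) is smooth. -/
def IsSmoothVar (X : Set (PS k n)) (m : ℕ) : Prop := ∀ p ∈ X, IsSmoothPt X m p

/-- The hyperplane (as a submodule) determined by a point of the dual projective space. -/
def hypSub (a : PS k n) : Submodule k (Fin n → k) :=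
  LinearMap.ker (∑ i, a.rep i • (LinearMap.proj i : (Fin n → k) →ₗ[k] k))

/-- The hyperplane determined by a point of the dual projective space. -/
def hypOf (a : PS k n) : Set (PS k n) := linSet (hypSub a)

/-- The (geometric) genus of a space curve `C`, defined by the node count of a
projection from a general point of its span: a general point of `⟨C⟩` lies on
`(d-1)(d-2)/2 - g` secant lines of `C`. -/
def HasGenus (C : Set (PS k n)) (g : ℕ) : Prop :=
  ∃ d : ℕ, HasDegree C 1 d ∧
    GenericIn (linSet (pspan C)) (fun q =>
      2 * (decomps C q).ncard + 2 * g + 3 * d = d * d + 2)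

/-- The embedded tangent space of `X` at `p` (as a submodule of the cone). -/
def tangentSub (X : Set (PS k n)) (p : PS k n) : Submodule k (Fin n → k) :=
  ⨅ f ∈ homogCut X,
    LinearMap.ker (∑ i, (eval p.rep (pderiv i f)) • (LinearMap.proj i : (Fin n → k) →ₗ[k] k))

/-- A curve is tangentially degenerate if its general tangent line meets the
curve elsewhere. -/
def TangDeg (X : Set (PS k n)) : Prop :=
  GenericIn {p ∈ X | IsSmoothPt X 1 p}
    (fun p => ∃ y ∈ X, y ≠ p ∧ y.submodule ≤ tangentSub X p)

/-- The homogeneous ideal of `X`. -/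
def projIdeal (X : Set (PS k n)) : Ideal (MvPolynomial (Fin n) k) :=
  Ideal.span {f | X ⊆ V0 f}

/-- `X` is a normal variety: its homogeneous coordinate ring is integrally closed
in its total fraction ring. -/
def IsNormalVar (X : Set (PS k n)) : Prop :=
  ∀ x : FractionRing (MvPolynomial (Fin n) k ⧸ projIdeal X),
    IsIntegral (MvPolynomial (Fin n) k ⧸ projIdeal X) x →
      ∃ y : MvPolynomial (Fin n) k ⧸ projIdeal X,
        algebraMap (MvPolynomial (Fin n) k ⧸ projIdeal X)
          (FractionRing (MvPolynomial (Fin n) k ⧸ projIdeal X)) y = x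

/-- `C` is an irreducible component of `Y`. -/
def IsCompOf (C Y : Set (PS k n)) : Prop :=
  Maximal (fun Z => Z ⊆ Y ∧ IsIrreducible Z) C

/-- The image of `X` under the linear projection from (the linear space of) `W`,
realized inside the complementary linear space of `Λ`. -/
def projFrom (W Λ : Submodule k (Fin n → k)) (X : Set (PS k n)) : Set (PS k n) :=
  {y | y.submodule ≤ Λ ∧ ∃ x ∈ X, y.submodule ≤ W ⊔ x.submodule}

/-- Decompositions of `q` as irredundant spans of one point from each `Xs i`. -/
def tupleDecomps {s : ℕ} (Xs : Fin s → Set (PS k n)) (q : PS k n) :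
    Set (Fin s → PS k n) :=
  {p | (∀ i, p i ∈ Xs i) ∧ Function.Injective p ∧ memSpan q (Set.range p) ∧
    ∀ i, ¬ memSpan q (Set.range p \ {p i})}

/-- The entry locus of `q` with respect to the tuple of varieties `Xs`. -/
def entryLocusT {s : ℕ} (Xs : Fin s → Set (PS k n)) (q : PS k n) : Set (PS k n) :=
  closure (⋃ p ∈ tupleDecomps Xs q, Set.range p)

/-- The join of the varieties `Xs`. -/
def joinT {s : ℕ} (Xs : Fin s → Set (PS k n)) : Set (PS k n) :=
  closure {q | ∃ p : Fin s → PS k n, (∀ i, p i ∈ Xs i) ∧ memSpan q (Set.range p)}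

/-- Relation `q = F(p)` for a tuple `F` of homogeneous polynomials of the same degree. -/
def polyMapRel {N M : ℕ} (F : Fin M → MvPolynomial (Fin N) k) (p : PS k N) (q : PS k M) :
    Prop :=
  q.submodule = Submodule.span k {fun j => eval p.rep (F j)}

/-- `A` and `B` are isomorphic via mutually inverse polynomial maps. -/
def IsPolyIso {N M : ℕ} (A : Set (PS k N)) (B : Set (PS k M)) : Prop :=
  ∃ (d e : ℕ) (F : Fin M → MvPolynomial (Fin N) k) (G : Fin N → MvPolynomial (Fin M) k),
    (∀ j, (F j).IsHomogeneous d) ∧ (∀ i, (G i).IsHomogeneous e) ∧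
    (∀ p ∈ A, ∃ q ∈ B, polyMapRel F p q ∧ polyMapRel G q p) ∧
    (∀ q ∈ B, ∃ p ∈ A, polyMapRel F p q ∧ polyMapRel G q p)

/-- `A` and `B` are birational: polynomially isomorphic on dense open subsets. -/
def Birational (A B : Set (PS k n)) : Prop :=
  ∃ U V : Set (PS k n), IsOpen U ∧ IsOpen V ∧
    A ⊆ closure (A ∩ U) ∧ B ⊆ closure (B ∩ V) ∧ IsPolyIso (A ∩ U) (B ∩ V)

/-- A finite set `S` imposes independent conditions on hypersurfaces of degree `i`. -/
def ImposesIndep (S : Finset (PS k n)) (i : ℕ) : Prop :=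
  Function.Surjective (fun f : ↥(homogeneousSubmodule (Fin n) k i) =>
    fun p : ↥(↑S : Set (PS k n)) => eval (↑p : PS k n).rep (↑f : MvPolynomial (Fin n) k))

end EL

namespace ConeSec

section Irr

variable {k : Type} [Field k] {σ τ : Type}

/-- A set of points is irreducible when its vanishing ideal is prime. -/
def Irr (Y : Set (σ → k)) : Prop := (vanishingIdeal k Y).IsPrime

/-- A set of points is Zariski closed when it contains the zero locus of its ideal. -/
def ZClosed (Y : Set (σ → k)) : Prop :=
  ∀ w : σ → k, (∀ f ∈ vanishingIdeal k Y, aeval w f = 0) → w ∈ Y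

theorem irr_iff {Y : Set (σ → k)} : Irr Y ↔ Y.Nonempty ∧
    ∀ f g : MvPolynomial σ k, (∃ y ∈ Y, aeval y f ≠ 0) → (∃ y ∈ Y, aeval y g ≠ 0) →
      ∃ y ∈ Y, aeval y f ≠ 0 ∧ aeval y g ≠ 0 := by
  constructor
  · intro h
    refine ⟨?_, fun f g ⟨y, hy, hf⟩ ⟨y', hy', hg⟩ => ?_⟩
    · by_contra hne
      rw [Set.not_nonempty_iff_eq_empty] at hne
      subst hne
      exact h.ne_top vanishingIdeal_empty
    · by_contra! hcon
      have : f * g ∈ vanishingIdeal k Y := by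
        intro x hx
        by_cases hfx : aeval x f = 0
        · rw [map_mul, hfx, zero_mul]
        · rw [map_mul, hcon x hx hfx, mul_zero]
      rcases h.mem_or_mem this with h1 | h1
      · exact hf (h1 y hy)
      · exact hg (h1 y' hy')
  · rintro ⟨⟨y, hy⟩, h⟩
    refine ⟨?_, ?_⟩
    · intro htop
      have : (1 : MvPolynomial σ k) ∈ vanishingIdeal k Y := by rw [htop]; trivial
      have := this y hy
      simp at this
    · intro f g hfg
      by_contra! hcon
      obtain ⟨h1, h2⟩ := hcon
      simp only [mem_vanishingIdeal_iff, not_forall] at h1 h2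
      obtain ⟨y1, hy1, h1⟩ := h1
      obtain ⟨y2, hy2, h2⟩ := h2
      obtain ⟨z, hz, hz1, hz2⟩ := h f g ⟨y1, hy1, h1⟩ ⟨y2, hy2, h2⟩
      have := hfg z hz
      rw [map_mul] at this
      exact mul_ne_zero hz1 hz2 this

theorem Irr.image {Y : Set (τ → k)} (hY : Irr Y) (φ : (τ → k) → (σ → k))
    (F : σ → MvPolynomial τ k) (hF : ∀ y ∈ Y, ∀ i, φ y i = aeval y (F i)) : Irr (φ '' Y) := by
  have key : ∀ (f : MvPolynomial σ k), ∀ y ∈ Y, aeval (φ y) f = aeval y (bind₁ F f) := by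
    intro f y hy
    rw [aeval_bind₁]
    congr 2
    funext i
    exact hF y hy i
  rw [irr_iff] at hY ⊢
  refine ⟨hY.1.image φ, ?_⟩
  rintro f g ⟨_, ⟨y, hy, rfl⟩, hf⟩ ⟨_, ⟨y', hy', rfl⟩, hg⟩
  rw [key _ _ hy] at hf
  rw [key _ _ hy'] at hg
  obtain ⟨z, hz, h1, h2⟩ := hY.2 _ _ ⟨y, hy, hf⟩ ⟨y', hy', hg⟩
  refine ⟨φ z, ⟨z, hz, rfl⟩, ?_, ?_⟩
  · rwa [key _ _ hz]
  · rwa [key _ _ hz]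

/-- The polynomial representing a linear functional. -/
def linPoly [Fintype σ] [DecidableEq σ] (φ : (σ → k) →ₗ[k] k) : MvPolynomial σ k :=
  ∑ i, C (φ (Pi.single i 1)) * X i

theorem aeval_linPoly [Fintype σ] [DecidableEq σ] (φ : (σ → k) →ₗ[k] k) (w : σ → k) :
    aeval w (linPoly φ) = φ w := by
  conv_rhs => rw [pi_eq_sum_univ' w]
  simp only [linPoly, map_sum, map_mul, algHom_C, Algebra.algebraMap_self, RingHom.id_apply,
    aeval_X, map_smul, smul_eq_mul]
  refine Finset.sum_congr rfl fun i _ => ?_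
  rw [mul_comm]

theorem linPoly_isHomogeneous [Fintype σ] [DecidableEq σ] (φ : (σ → k) →ₗ[k] k) :
    (linPoly φ).IsHomogeneous 1 := by
  refine IsHomogeneous.sum _ _ _ fun i _ => ?_
  simpa using (isHomogeneous_C σ (φ (Pi.single i 1))).mul (isHomogeneous_X k i)

theorem Irr.linImage [Fintype τ] [DecidableEq τ] {Y : Set (τ → k)} (hY : Irr Y)
    (φ : (τ → k) →ₗ[k] (σ → k)) : Irr (φ '' Y) :=
  hY.image φ (fun i => linPoly ((LinearMap.proj i).comp φ)) fun y _ i => by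
    rw [aeval_linPoly]; rfl

theorem Irr.prod {Y : Set (σ → k)} {Z : Set (τ → k)} (hY : Irr Y) (hZ : Irr Z) :
    Irr {w : σ ⊕ τ → k | (fun i => w (Sum.inl i)) ∈ Y ∧ (fun i => w (Sum.inr i)) ∈ Z} := by
  have sl : ∀ (f : MvPolynomial (σ ⊕ τ) k) (w : σ ⊕ τ → k),
      aeval (fun i => w (Sum.inl i))
        (aeval (Sum.elim X (fun j => C (w (Sum.inr j)))) f : MvPolynomial σ k) = aeval w f := by
    intro f w
    rw [← AlgHom.comp_apply, comp_aeval]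
    congr 2
    funext i
    rcases i with i | i <;> simp
  have sr : ∀ (f : MvPolynomial (σ ⊕ τ) k) (w : σ ⊕ τ → k),
      aeval (fun i => w (Sum.inr i))
        (aeval (Sum.elim (fun j => C (w (Sum.inl j))) X) f : MvPolynomial τ k) = aeval w f := by
    intro f w
    rw [← AlgHom.comp_apply, comp_aeval]
    congr 2
    funext i
    rcases i with i | i <;> simp
  rw [irr_iff] at hY hZ ⊢
  obtain ⟨⟨y0, hy0⟩, hY⟩ := hY
  obtain ⟨⟨z0, hz0⟩, hZ⟩ := hZ
  refine ⟨⟨Sum.elim y0 z0, by simpa using ⟨hy0, hz0⟩⟩, ?_⟩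
  rintro f g ⟨w1, ⟨h1l, h1r⟩, hf⟩ ⟨w2, ⟨h2l, h2r⟩, hg⟩
  rw [← sl] at hf hg
  obtain ⟨y, hy, hfy, hgy⟩ := hY _ _ ⟨_, h1l, hf⟩ ⟨_, h2l, hg⟩
  have e1 := sl f (Sum.elim y (fun j => w1 (Sum.inr j)))
  have e2 := sl g (Sum.elim y (fun j => w2 (Sum.inr j)))
  simp only [Sum.elim_inl, Sum.elim_inr] at e1 e2
  rw [e1, ← sr] at hfy
  rw [e2, ← sr] at hgy
  simp only [Sum.elim_inl, Sum.elim_inr] at hfy hgy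
  obtain ⟨z, hz, hfz, hgz⟩ := hZ _ _ ⟨_, h1r, hfy⟩ ⟨_, h2r, hgy⟩
  refine ⟨Sum.elim y z, by simpa using ⟨hy, hz⟩, ?_, ?_⟩
  · have := sr f (Sum.elim y z)
    simp only [Sum.elim_inl, Sum.elim_inr] at this
    rwa [← this]
  · have := sr g (Sum.elim y z)
    simp only [Sum.elim_inl, Sum.elim_inr] at this
    rwa [← this]

theorem Irr.add {Y Z : Set (σ → k)} (hY : Irr Y) (hZ : Irr Z) :
    Irr {w : σ → k | ∃ a ∈ Y, ∃ b ∈ Z, w = a + b} := by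
  have := (hY.prod hZ).image (fun w i => w (Sum.inl i) + w (Sum.inr i))
    (fun i => X (Sum.inl i) + X (Sum.inr i)) (by intro y _ i; simp)
  convert this using 1
  ext w
  constructor
  · rintro ⟨a, ha, b, hb, rfl⟩
    exact ⟨Sum.elim a b, by simpa using ⟨ha, hb⟩, by ext; simp⟩
  · rintro ⟨u, ⟨h1, h2⟩, rfl⟩
    exact ⟨_, h1, _, h2, rfl⟩

theorem irr_univ [Infinite k] : Irr (Set.univ : Set (σ → k)) := by
  unfold Irr
  have : vanishingIdeal k (Set.univ : Set (σ → k)) = ⊥ := by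
    rw [eq_bot_iff]
    intro f hf
    rw [Ideal.mem_bot]
    apply MvPolynomial.funext
    intro x
    have := hf x trivial
    rw [aeval_eq_eval] at this
    simpa using this
  rw [this]
  exact Ideal.isPrime_bot

theorem irr_line [Infinite k] (p : σ → k) : Irr {w : σ → k | ∃ t : k, w = t • p} := by
  have := (irr_univ (k := k) (σ := Unit)).image (fun w i => w () * p i)
    (fun i => X () * C (p i)) (by intro y _ i; simp)
  convert this using 1
  ext w
  constructor
  · rintro ⟨t, rfl⟩
    exact ⟨fun _ => t, trivial, by ext; simp⟩
  · rintro ⟨u, -, rfl⟩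
    exact ⟨u (), by ext; simp⟩

theorem irr_singleton (p : σ → k) : Irr {p} := by
  rw [irr_iff]
  refine ⟨⟨p, rfl⟩, ?_⟩
  rintro f g ⟨_, rfl, h1⟩ ⟨_, rfl, h2⟩
  exact ⟨_, rfl, h1, h2⟩

theorem zclosed_submodule [Fintype σ] [DecidableEq σ] (W : Submodule k (σ → k)) :
    ZClosed (W : Set (σ → k)) := by
  intro w hw
  by_contra hwW
  obtain ⟨φ, h1, h2⟩ := Submodule.exists_le_ker_of_notMem hwW
  refine h1 ?_
  rw [← aeval_linPoly]
  refine hw _ fun x hx => ?_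
  rw [aeval_linPoly]
  exact h2 hx

theorem zclosed_singleton (p : σ → k) : ZClosed {p} := by
  intro w hw
  ext i
  have := hw (X i - C (p i)) (by intro x hx; rw [Set.mem_singleton_iff] at hx; subst hx; simp)
  simpa [sub_eq_zero] using this

theorem zclosed_line [Fintype σ] [DecidableEq σ] (p : σ → k) :
    ZClosed {w : σ → k | ∃ t : k, w = t • p} := by
  convert zclosed_submodule (Submodule.span k {p}) using 1
  ext w
  simp [Submodule.mem_span_singleton, eq_comm]

theorem Irr.subset_or [Fintype σ] [DecidableEq σ] {Y : Set (σ → k)} (hY : Irr Y)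
    (W₁ W₂ : Submodule k (σ → k)) (h : ∀ y ∈ Y, y ∈ W₁ ∨ y ∈ W₂) :
    Y ⊆ W₁ ∨ Y ⊆ W₂ := by
  by_contra! hcon
  obtain ⟨h1, h2⟩ := hcon
  obtain ⟨y1, hy1, hn1⟩ := Set.not_subset.1 h1
  obtain ⟨y2, hy2, hn2⟩ := Set.not_subset.1 h2
  obtain ⟨φ, hφ1, hφ2⟩ := Submodule.exists_le_ker_of_notMem hn1
  obtain ⟨ψ, hψ1, hψ2⟩ := Submodule.exists_le_ker_of_notMem hn2
  obtain ⟨z, hz, hz1, hz2⟩ := (irr_iff.1 hY).2 (linPoly φ) (linPoly ψ)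
    ⟨y1, hy1, by rwa [aeval_linPoly]⟩ ⟨y2, hy2, by rwa [aeval_linPoly]⟩
  rw [aeval_linPoly] at hz1 hz2
  rcases h z hz with hh | hh
  · exact hz1 (hφ2 hh)
  · exact hz2 (hψ2 hh)

end Irr

section Rank

variable {k : Type} [Field k] {σ : Type}

/-- The algebraic rank of a set of elements of a field extension. -/
abbrev ark (k : Type) [Field k] {L : Type} [Field L] [Algebra k L] (S : Set L) : ℕ∞ :=
  (AlgebraicIndependent.matroid k L).eRk S

/-- Every zero of `I` in a field extension has coordinates of algebraic rank at most `m`. -/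
def RkLE (I : Ideal (MvPolynomial σ k)) (m : ℕ) : Prop :=
  ∀ (L : Type) [Field L] [Algebra k L] (x : σ → L), (∀ f ∈ I, aeval x f = 0) →
    ark k (Set.range x) ≤ m

theorem rkLE_of_generic {I : Ideal (MvPolynomial σ k)} {m : ℕ} {L₀ : Type} [Field L₀]
    [Algebra k L₀] (ξ : σ → L₀) (hξ : ∀ f, aeval ξ f = 0 → f ∈ I)
    (hr : ark k (Set.range ξ) ≤ m) : RkLE I m := by
  intro L _ _ x hx
  refine Matroid.eRk_le_iff.2 fun J hJ hind => ?_
  choose i hi using fun j : J => hJ j.2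
  have hxi : (fun j : J => x (i j)) = fun j : J => (j : L) := funext hi
  have hind' : AlgebraicIndependent k (fun j : J => (j : L)) := hind
  have hξi : AlgebraicIndependent k (fun j : J => ξ (i j)) := by
    rw [algebraicIndependent_iff]
    intro P hP
    have h1 : aeval ξ (rename i P) = 0 := by rw [aeval_rename]; exact hP
    have h2 := hx _ (hξ _ h1)
    rw [aeval_rename] at h2
    exact (algebraicIndependent_iff.1 hind') P (by rw [← hxi]; exact h2)
  have hinj : Function.Injective (fun j : J => ξ (i j)) := hξi.injective
  have hle : (Set.range fun j : J => ξ (i j)).encard ≤ m := by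
    refine Matroid.eRk_le_iff.1 hr (Set.range_subset_iff.2 fun j => ⟨i j, rfl⟩) ?_
    exact hξi.coe_range
  rwa [← Set.image_univ, hinj.encard_image, Set.encard_univ, ENat.card_coe_set_eq] at hle

theorem ark_le_of_algebraic {L : Type} [Field L] [Algebra k L] {S T : Set L}
    (h : ∀ t ∈ T, IsAlgebraic (Algebra.adjoin k S) t) : ark k T ≤ ark k S := by
  have : T ⊆ (AlgebraicIndependent.matroid k L).closure S := by
    rw [AlgebraicIndependent.matroid_closure_eq]
    intro t ht
    exact h t ht
  calc ark k T ≤ ark k ((AlgebraicIndependent.matroid k L).closure S) := Matroid.eRk_mono _ this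
    _ = ark k S := Matroid.eRk_closure_eq _ _

theorem ark_union_le {L : Type} [Field L] [Algebra k L] (S T : Set L) :
    ark k (S ∪ T) ≤ ark k S + ark k T := Matroid.eRk_union_le_eRk_add_eRk _ _ _

theorem ringKrullDim_le_of_integral {R S : Type} [CommRing R] [CommRing S] [Algebra R S]
    [FaithfulSMul R S] [Algebra.IsIntegral R S] : ringKrullDim R ≤ ringKrullDim S := by
  refine iSup_le fun l => ?_
  obtain ⟨⟨P, hP, hlo⟩⟩ := Ideal.nonempty_primesOver (S := S) (RelSeries.head l).asIdeal
  obtain ⟨L, hL, -, -⟩ := Ideal.exists_ltSeries_of_hasGoingUp l P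
  rw [← hL]
  exact Order.LTSeries.length_le_krullDim L

/-- The tautological zero of a prime ideal, with coordinates in the fraction field. -/
def genPt (I : Ideal (MvPolynomial σ k)) [I.IsPrime] (i : σ) :
    FractionRing (MvPolynomial σ k ⧸ I) :=
  algebraMap (MvPolynomial σ k ⧸ I) _ (Ideal.Quotient.mk I (X i))

theorem aeval_genPt (I : Ideal (MvPolynomial σ k)) [I.IsPrime] (f : MvPolynomial σ k) :
    aeval (genPt I) f =
      algebraMap (MvPolynomial σ k ⧸ I) (FractionRing (MvPolynomial σ k ⧸ I))
        (Ideal.Quotient.mk I f) := by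
  have : (aeval (genPt I) : MvPolynomial σ k →ₐ[k] FractionRing (MvPolynomial σ k ⧸ I)) =
      (IsScalarTower.toAlgHom k (MvPolynomial σ k ⧸ I) _).comp (Ideal.Quotient.mkₐ k I) := by
    ext i
    simp [genPt]
  rw [this]
  rfl

theorem aeval_genPt_eq_zero (I : Ideal (MvPolynomial σ k)) [I.IsPrime] (f : MvPolynomial σ k) :
    aeval (genPt I) f = 0 ↔ f ∈ I := by
  rw [aeval_genPt, FaithfulSMul.algebraMap_eq_zero_iff, Ideal.Quotient.eq_zero_iff_mem]

theorem rkLE_of_ringKrullDim_le [Finite σ] (I : Ideal (MvPolynomial σ k)) [hI : I.IsPrime] {m : ℕ}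
    (h : ringKrullDim (MvPolynomial σ k ⧸ I) ≤ m) : RkLE I m := by
  obtain ⟨s, g, hinj, hinteg⟩ := exists_integral_inj_algHom_of_fg k (MvPolynomial σ k ⧸ I)
  algebraize [g.toRingHom]
  have : Algebra.IsIntegral (MvPolynomial (Fin s) k) (MvPolynomial σ k ⧸ I) := ⟨hinteg⟩
  have : FaithfulSMul (MvPolynomial (Fin s) k) (MvPolynomial σ k ⧸ I) :=
    (faithfulSMul_iff_algebraMap_injective _ _).2 hinj
  have hs : (s : WithBot ℕ∞) ≤ m := by
    refine le_trans ?_ ((ringKrullDim_le_of_integral (R := MvPolynomial (Fin s) k)).trans h)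
    rw [MvPolynomial.ringKrullDim_of_isNoetherianRing]
    simp
  have hs' : s ≤ m := by exact_mod_cast hs
  let L := FractionRing (MvPolynomial σ k ⧸ I)
  let t : Fin s → L := fun j => algebraMap (MvPolynomial σ k ⧸ I) L (g (X j))
  have halg : ∀ r : MvPolynomial σ k ⧸ I,
      IsAlgebraic (Algebra.adjoin k (Set.range t)) (algebraMap _ L r) := by
    intro r
    let φ : MvPolynomial (Fin s) k →ₐ[k] Algebra.adjoin k (Set.range t) :=
      aeval fun j => ⟨t j, Algebra.subset_adjoin ⟨j, rfl⟩⟩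
    refine (IsIntegral.map_of_comp_eq (φ : MvPolynomial (Fin s) k →+* _)
      (algebraMap (MvPolynomial σ k ⧸ I) L) ?_ (hinteg r)).isAlgebraic
    refine MvPolynomial.ringHom_ext (fun c => ?_) fun j => ?_
    · have : (algebraMap (MvPolynomial (Fin s) k) (MvPolynomial σ k ⧸ I)) (C c) =
          algebraMap k _ c := g.commutes c
      simp only [RingHom.comp_apply, this]
      rw [← IsScalarTower.algebraMap_apply k (MvPolynomial σ k ⧸ I) L]
      simp [φ]
    · simp only [RingHom.comp_apply]
      simp [φ, t]
      rfl
  refine rkLE_of_generic (genPt I) (fun f => (aeval_genPt_eq_zero I f).1) ?_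
  calc ark k (Set.range (genPt I)) ≤ ark k (Set.range t) :=
        by
          refine ark_le_of_algebraic ?_
          rintro _ ⟨i, rfl⟩
          exact halg _
    _ ≤ (Set.range t).encard := Matroid.eRk_le_encard _ _
    _ ≤ m := by
      rw [← Set.image_univ]
      refine (Set.encard_image_le _ _).trans ?_
      rw [Set.encard_univ]
      simpa using hs'

end Rank

section Dominance

variable {k : Type} [Field k]

theorem vanishingIdeal_lt {σ : Type} {Y Z : Set (σ → k)} (hYZ : Y ⊆ Z) (hY : ZClosed Y)
    (hne : ¬ Z ⊆ Y) : vanishingIdeal k Z < vanishingIdeal k Y := by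
  refine lt_of_le_of_ne (vanishingIdeal_anti_mono hYZ) fun h => hne fun w hw => hY w fun f hf => ?_
  rw [← h] at hf
  exact hf w hw

theorem chain_length_le {σ : Type} [Finite σ] (s : LTSeries (Ideal (MvPolynomial σ k)))
    (hs : ∀ i, (s i).IsPrime) : s.length ≤ Nat.card σ := by
  let s' : LTSeries (PrimeSpectrum (MvPolynomial σ k)) :=
    { length := s.length
      toFun := fun i => ⟨s i, hs i⟩
      step := fun i => s.step i }
  have h1 := Order.LTSeries.length_le_krullDim s'
  have h2 := MvPolynomial.ringKrullDim_of_isNoetherianRing (R := k) (ι := σ)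
  rw [ringKrullDim] at h2
  rw [h2] at h1
  have h3 : ringKrullDim k = 0 := ringKrullDim_eq_zero_of_field k
  rw [h3, zero_add] at h1
  exact_mod_cast h1

variable [Infinite k]

/-- The translations preserving a set form a subspace when they are closed under scaling. -/
def transSub {σ : Type} (Y : Set (σ → k)) : Submodule k (σ → k) where
  carrier := {u | ∀ w ∈ Y, ∀ t : k, w + t • u ∈ Y}
  zero_mem' := by intro w hw t; simpa using hw
  add_mem' := by
    intro a b ha hb w hw t
    rw [smul_add, ← add_assoc]
    exact hb _ (ha _ hw t) t
  smul_mem' := by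
    intro c a ha w hw t
    rw [smul_smul]
    exact ha _ hw _

theorem add_dominant {K : Set (Fin 4 → k)} (hirr : Irr K) (hcl : ZClosed K)
    (h0 : (0 : Fin 4 → k) ∈ K) (hcone : ∀ w ∈ K, ∀ t : k, t • w ∈ K)
    (hspan : Submodule.span k K = ⊤) (hne : K ≠ Set.univ) :
    vanishingIdeal k {w | ∃ a ∈ K, ∃ b ∈ K, w = a + b} = ⊥ := by
  set P := vanishingIdeal k {w | ∃ a ∈ K, ∃ b ∈ K, w = a + b} with hP
  by_contra hPne
  have hPprime : P.IsPrime := hirr.add hirr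
  have stable : ∀ p ∈ K, p ∉ transSub K → p ∈ transSub (zeroLocus k P) := by
    intro p hp hbad
    have hlineK : {w : Fin 4 → k | ∃ t : k, w = t • p} ⊆ K := by
      rintro _ ⟨t, rfl⟩; exact hcone _ hp t
    have hp0 : p ≠ 0 := by rintro rfl; exact hbad (zero_mem _)
    have hlt1 : vanishingIdeal k K < vanishingIdeal k {w : Fin 4 → k | ∃ t : k, w = t • p} := by
      refine vanishingIdeal_lt hlineK (zclosed_line p) fun hsub => ?_
      have h1 : Submodule.span k K ≤ Submodule.span k {p} := by
        rw [Submodule.span_le]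
        intro w hw
        obtain ⟨t, rfl⟩ := hsub hw
        exact Submodule.smul_mem _ _ (Submodule.mem_span_singleton_self p)
      rw [hspan, top_le_iff] at h1
      have h2 := finrank_span_singleton (K := k) hp0
      rw [h1, finrank_top] at h2
      simp at h2
    have hlt2 : vanishingIdeal k {w : Fin 4 → k | ∃ t : k, w = t • p} <
        vanishingIdeal k {(0 : Fin 4 → k)} := by
      refine vanishingIdeal_lt ?_ (zclosed_singleton 0) fun hsub => hp0 ?_
      · rintro _ rfl; exact ⟨0, by simp⟩
      · exact hsub ⟨1, by simp⟩
    set Q := vanishingIdeal k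
      {w | ∃ a ∈ K, ∃ b ∈ {w : Fin 4 → k | ∃ t : k, w = t • p}, w = a + b} with hQ
    have hQprime : Q.IsPrime := hirr.add (irr_line p)
    have hlt3 : Q < vanishingIdeal k K := by
      refine vanishingIdeal_lt ?_ hcl fun hsub => hbad fun w hw t => ?_
      · intro w hw; exact ⟨w, hw, 0, ⟨0, by simp⟩, by simp⟩
      · exact hsub ⟨w, hw, _, ⟨t, rfl⟩, rfl⟩
    have hPQ : P ≤ Q := by
      apply vanishingIdeal_anti_mono
      rintro _ ⟨a, ha, b, hb, rfl⟩
      exact ⟨a, ha, b, hlineK hb, rfl⟩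
    have hPQ' : P = Q := by
      by_contra hPQne
      have hlt4 : P < Q := lt_of_le_of_ne hPQ hPQne
      have hlt5 : ⊥ < P := bot_lt_iff_ne_bot.2 hPne
      let s : LTSeries (Ideal (MvPolynomial (Fin 4) k)) :=
        { length := 5
          toFun := ![⊥, P, Q, vanishingIdeal k K,
            vanishingIdeal k {w : Fin 4 → k | ∃ t : k, w = t • p}, vanishingIdeal k {0}]
          step := by
            intro i
            fin_cases i <;> assumption }
      have := chain_length_le s (by
        intro i
        fin_cases i
        · exact Ideal.isPrime_bot
        · exact hPprime
        · exact hQprime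
        · exact hirr
        · exact irr_line p
        · exact irr_singleton 0)
      simp [s] at this
    intro w hw t f hf
    have hshift : ∀ x : Fin 4 → k,
        aeval x (aeval (fun i => X i + C (t * p i)) f : MvPolynomial (Fin 4) k) =
          aeval (x + t • p) f := by
      intro x
      rw [← AlgHom.comp_apply, comp_aeval]
      congr 2
      funext i
      simp
    rw [← hshift]
    refine hw _ ?_
    rw [hPQ']
    rw [hPQ'] at hf
    rintro _ ⟨a, ha, _, ⟨t', rfl⟩, rfl⟩
    rw [hshift]
    exact hf _ ⟨a, ha, _, ⟨t' + t, rfl⟩, by rw [add_smul, add_assoc]⟩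
  rcases hirr.subset_or (transSub K) (transSub (zeroLocus k P)) (fun y hy => by
    by_cases h : y ∈ transSub K
    · exact Or.inl h
    · exact Or.inr (stable y hy h)) with h | h
  · have h1 : transSub K = ⊤ := by
      rw [eq_top_iff, ← hspan]; exact Submodule.span_le.2 h
    apply hne
    ext w
    simp only [Set.mem_univ, iff_true]
    have : w ∈ transSub K := by rw [h1]; trivial
    simpa using this 0 h0 1
  · have h1 : transSub (zeroLocus k P) = ⊤ := by
      rw [eq_top_iff, ← hspan]; exact Submodule.span_le.2 h
    apply hPne
    rw [eq_bot_iff]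
    intro f hf
    rw [Ideal.mem_bot]
    apply MvPolynomial.funext
    intro w
    have hw : w ∈ transSub (zeroLocus k P) := by rw [h1]; trivial
    have h0' : (0 : Fin 4 → k) ∈ zeroLocus k P := fun g hg => hg 0 ⟨0, h0, 0, h0, by simp⟩
    have := hw 0 h0' 1 f hf
    rw [aeval_eq_eval] at this
    simpa using this

end Dominance

section Fibres

variable {k : Type} [Field k]

theorem isAlgebraic_of_ark_le {L ι : Type} [Field L] [Algebra k L] [Finite ι] {x : ι → L}
    (hx : AlgebraicIndependent k x) {S : Set L} (hS : ark k S ≤ Nat.card ι)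
    (hxS : ∀ i, x i ∈ Algebra.adjoin k S) {y : L} (hy : y ∈ S) :
    IsAlgebraic (Algebra.adjoin k (Set.range x)) y := by
  by_contra hcon
  have hind : (AlgebraicIndependent.matroid k L).Indep (Set.range x) := hx.coe_range
  have hy' : y ∉ (AlgebraicIndependent.matroid k L).closure (Set.range x) := by
    rw [AlgebraicIndependent.matroid_closure_eq]
    exact hcon
  have hins := (hind.notMem_closure_iff (by simp)).1 hy'
  have hle : (insert y (Set.range x)).encard ≤ Nat.card ι := by
    refine le_trans ?_ hS
    rw [← hins.1.eRk_eq_encard]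
    refine ark_le_of_algebraic ?_
    rintro t (rfl | ⟨i, rfl⟩)
    · exact isAlgebraic_algebraMap
        (⟨t, Algebra.subset_adjoin hy⟩ : Algebra.adjoin k S)
    · exact isAlgebraic_algebraMap (⟨x i, hxS i⟩ : Algebra.adjoin k S)
  rw [Set.encard_insert_of_notMem hins.2, ← Set.image_univ, hx.injective.encard_image,
    Set.encard_univ, ENat.card_eq_coe_natCard] at hle
  have : Nat.card ι + 1 ≤ Nat.card ι := by exact_mod_cast hle
  omega

/-- Homogenization: clearing denominators in a scaled substitution. -/
theorem exists_scaled {τ : Type} (p : MvPolynomial τ k) :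
    ∃ (D : ℕ) (P : MvPolynomial (Option τ) k), ∀ (S : Type) [CommRing S] [Algebra k S] (s : S)
      (x : τ → S), s ^ D * aeval x p = aeval (fun o => Option.elim o s fun j => s * x j) P := by
  induction p using MvPolynomial.induction_on with
  | C c => exact ⟨0, C c, fun S _ _ s x => by simp⟩
  | add p q hp hq =>
    obtain ⟨D, P, hP⟩ := hp
    obtain ⟨E, Q, hQ⟩ := hq
    refine ⟨D + E, X none ^ E * P + X none ^ D * Q, fun S _ _ s x => ?_⟩
    rw [map_add, map_add, map_mul, map_mul, ← hP, ← hQ]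
    simp
    ring
  | mul_X p i hp =>
    obtain ⟨D, P, hP⟩ := hp
    refine ⟨D + 1, P * X (some i), fun S _ _ s x => ?_⟩
    rw [map_mul, map_mul, ← hP]
    simp
    ring

theorem exists_poly_of_isAlgebraic {L σ : Type} [Field L] [Algebra k L] {ζ : σ → L}
    (hζ : AlgebraicIndependent k ζ) {y : L}
    (hy : IsAlgebraic (Algebra.adjoin k (Set.range ζ)) y) :
    ∃ q : Polynomial (MvPolynomial σ k), q ≠ 0 ∧
      q.eval₂ (aeval ζ : MvPolynomial σ k →ₐ[k] L).toRingHom y = 0 := by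
  obtain ⟨p, hp, hpy⟩ := hy
  refine ⟨p.map (hζ.aevalEquiv.symm : _ →+* MvPolynomial σ k), ?_, ?_⟩
  · rwa [Ne, Polynomial.map_eq_zero_iff]
    exact hζ.aevalEquiv.symm.injective
  · rw [Polynomial.eval₂_map, ← hpy, Polynomial.aeval_def]
    congr 1
    ext a
    obtain ⟨b, rfl⟩ := hζ.aevalEquiv.surjective a
    simp

end Fibres

section Fibres

variable {k : Type} [Field k]

theorem exists_point_of_integral [IsAlgClosed k] {σ τ : Type} (I : Ideal (MvPolynomial τ k))
    [I.IsPrime] (z : σ → MvPolynomial τ k)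
    (hinj : Function.Injective
      (aeval (fun i => Ideal.Quotient.mk I (z i)) : MvPolynomial σ k →ₐ[k] MvPolynomial τ k ⧸ I))
    (f : MvPolynomial σ k)
    (hf : ∀ j, (aeval (fun i => Ideal.Quotient.mk I (z i)) :
      MvPolynomial σ k →ₐ[k] MvPolynomial τ k ⧸ I).toRingHom.IsIntegralElem
        (aeval (fun i => Ideal.Quotient.mk I (z i)) f * Ideal.Quotient.mk I (X j)))
    (w : σ → k) (hw : aeval w f ≠ 0) :
    ∃ x ∈ zeroLocus k I, ∀ i, aeval x (z i) = w i := by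
  set φ : (MvPolynomial σ k) →ₐ[k] (MvPolynomial τ k ⧸ I) :=
    aeval (fun i => Ideal.Quotient.mk I (z i)) with hφ
  algebraize [φ.toRingHom]
  let T' := integralClosure (MvPolynomial σ k) (MvPolynomial τ k ⧸ I)
  have hAT' : Function.Injective (algebraMap (MvPolynomial σ k) T') := by
    intro a b hab
    exact hinj (congrArg Subtype.val hab)
  have : FaithfulSMul (MvPolynomial σ k) T' := (faithfulSMul_iff_algebraMap_injective _ _).2 hAT'
  let m : Ideal (MvPolynomial σ k) := RingHom.ker (aeval w : (MvPolynomial σ k) →ₐ[k] k)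
  have hm : m.IsMaximal := RingHom.ker_isMaximal_of_surjective _ fun c => ⟨C c, by simp [algHom_C]⟩
  have : Algebra.IsIntegral (MvPolynomial σ k) T' := integralClosure.AlgebraIsIntegral
  obtain ⟨Q, hQ, hQm⟩ := Ideal.exists_maximal_ideal_liesOver_of_isIntegral (S := T') m
  let F := T' ⧸ Q
  let _ : Field F := Ideal.Quotient.field Q
  have hmk : ∀ a : (MvPolynomial σ k), Ideal.Quotient.mk Q (algebraMap (MvPolynomial σ k) T' a) =
      algebraMap k F (aeval w a) := by
    intro a
    have h1 : a - C (aeval w a) ∈ m := by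
      change aeval w (a - C (aeval w a)) = 0
      simp
    have h2 : algebraMap (MvPolynomial σ k) T' (a - C (aeval w a)) ∈ Q := by
      rw [hQm.over] at h1
      exact h1
    rw [← Ideal.Quotient.eq_zero_iff_mem, map_sub, map_sub, sub_eq_zero] at h2
    rw [h2]
    refine congrArg (Ideal.Quotient.mk Q) (Subtype.ext ?_ : _ = algebraMap k T' (aeval w a))
    exact φ.commutes (aeval w a)
  have : Algebra.IsIntegral k F := by
    refine ⟨fun t => ?_⟩
    obtain ⟨t', rfl⟩ := Ideal.Quotient.mk_surjective t
    refine IsIntegral.map_of_comp_eq (aeval w : (MvPolynomial σ k) →ₐ[k] k).toRingHom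
      (Ideal.Quotient.mk Q) ?_
      (Algebra.IsIntegral.isIntegral (R := (MvPolynomial σ k)) t')
    exact RingHom.ext fun a => (hmk a).symm
  have hbij : Function.Bijective (algebraMap k F) :=
    IsAlgClosed.algebraMap_bijective_of_isIntegral
  let e : k ≃ₐ[k] F := AlgEquiv.ofBijective (Algebra.ofId k F) hbij
  let ψ : T' →ₐ[k] k := (e.symm : F →ₐ[k] k).comp (Ideal.Quotient.mkₐ k Q)
  have hψ : ∀ a : (MvPolynomial σ k), ψ (algebraMap (MvPolynomial σ k) T' a) = aeval w a := by
    intro a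
    change e.symm (Ideal.Quotient.mk Q (algebraMap (MvPolynomial σ k) T' a)) = _
    rw [hmk]
    exact e.symm_apply_apply _
  let g : τ → T' := fun j => ⟨φ f * Ideal.Quotient.mk I (X j), hf j⟩
  have hpt : ∀ (p : MvPolynomial τ k) (a : (MvPolynomial σ k)), Ideal.Quotient.mk I p = φ a →
      aeval (fun j => ψ (g j) / aeval w f) p = aeval w a := by
    intro p a hpa
    obtain ⟨D, P, hP⟩ := exists_scaled p
    have h1 := hP k (aeval w f) (fun j => ψ (g j) / aeval w f)
    have h2 : (algebraMap (MvPolynomial σ k) T' f) ^ D * algebraMap (MvPolynomial σ k) T' a =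
        aeval (fun o => Option.elim o (algebraMap (MvPolynomial σ k) T' f) g) P := by
      apply Subtype.val_injective
      have h3 := hP (MvPolynomial τ k ⧸ I) (φ f) (fun j => Ideal.Quotient.mk I (X j))
      have h4 : aeval (fun j => Ideal.Quotient.mk I (X j)) p = Ideal.Quotient.mk I p := by
        have : (aeval (fun j => Ideal.Quotient.mk I (X j)) :
            MvPolynomial τ k →ₐ[k] (MvPolynomial τ k ⧸ I)) =
          Ideal.Quotient.mkₐ k I := by ext j; simp
        rw [this]; rfl
      rw [h4, hpa] at h3
      have h5 : ((aeval (fun o => Option.elim o (algebraMap (MvPolynomial σ k) T' f) g) P : T') :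
          (MvPolynomial τ k ⧸ I)) =
          aeval (fun o => Option.elim o (φ f) fun j => φ f * Ideal.Quotient.mk I (X j)) P := by
        have := congrArg (fun h : MvPolynomial (Option τ) k →ₐ[k] (MvPolynomial τ k ⧸ I) => h P)
          (comp_aeval (R := k) (fun o => Option.elim o (algebraMap (MvPolynomial σ k) T' f) g)
            ((T'.val).restrictScalars k))
        refine this.trans ?_
        congr 2
        funext o
        cases o <;> rfl
      rw [h5, ← h3]
      rfl
    have h6 := congrArg ψ h2
    rw [map_mul, map_pow, hψ, hψ] at h6
    have h7 : ψ (aeval (fun o => Option.elim o (algebraMap (MvPolynomial σ k) T' f) g) P) =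
        aeval (fun o => Option.elim o (aeval w f) fun j => ψ (g j)) P := by
      rw [← AlgHom.comp_apply, comp_aeval]
      congr 2
      funext o
      cases o
      · exact hψ f
      · rfl
    rw [h7] at h6
    have h8 : (fun o : Option τ => Option.elim o (aeval w f)
        fun j => aeval w f * (ψ (g j) / aeval w f)) =
        (fun o => Option.elim o (aeval w f) fun j => ψ (g j)) := by
      funext o
      cases o
      · rfl
      · simp only [Option.elim_some]
        rw [mul_div_cancel₀ _ hw]
    rw [h8, ← h6] at h1
    exact mul_left_cancel₀ (pow_ne_zero _ hw) h1
  refine ⟨fun j => ψ (g j) / aeval w f, fun p hp => ?_, fun i => ?_⟩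
  · have := hpt p 0 (by rw [map_zero]; exact Ideal.Quotient.eq_zero_iff_mem.2 hp)
    rwa [map_zero] at this
  · rw [hpt (z i) (X i) (by rw [hφ, aeval_X]), aeval_X]

theorem finite_fibres [IsAlgClosed k] {σ τ : Type} [Finite σ] [Finite τ]
    (I : Ideal (MvPolynomial τ k)) [I.IsPrime] (z : σ → MvPolynomial τ k)
    (hind : AlgebraicIndependent k fun i => aeval (genPt I) (z i))
    (hrk : RkLE I (Nat.card σ)) :
    ∃ f : MvPolynomial σ k, f ≠ 0 ∧ ∀ w : σ → k, aeval w f ≠ 0 →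
      {x | x ∈ zeroLocus k I ∧ ∀ i, aeval x (z i) = w i}.Finite ∧
      {x | x ∈ zeroLocus k I ∧ ∀ i, aeval x (z i) = w i}.Nonempty := by
  have := Fintype.ofFinite τ
  have hgen : ∀ f ∈ I, aeval (genPt I) f = 0 := fun f hf => (aeval_genPt_eq_zero I f).2 hf
  have halg : ∀ j, IsAlgebraic
      (Algebra.adjoin k (Set.range fun i => aeval (genPt I) (z i))) (genPt I j) := fun j => by
    refine isAlgebraic_of_ark_le hind (hrk _ (genPt I) hgen) (fun i => ?_) ⟨j, rfl⟩
    rw [← aeval_range]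
    exact ⟨z i, rfl⟩
  choose q hq0 hq using fun j => exists_poly_of_isAlgebraic hind (halg j)
  set φ : MvPolynomial σ k →ₐ[k] MvPolynomial τ k ⧸ I :=
    aeval fun i => Ideal.Quotient.mk I (z i) with hφ
  have hφL : ∀ a, algebraMap (MvPolynomial τ k ⧸ I) (FractionRing (MvPolynomial τ k ⧸ I)) (φ a) =
      aeval (fun i => aeval (genPt I) (z i)) a := by
    intro a
    have : (IsScalarTower.toAlgHom k (MvPolynomial τ k ⧸ I)
        (FractionRing (MvPolynomial τ k ⧸ I))).comp φ =
        aeval (fun i => aeval (genPt I) (z i)) := by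
      ext i
      simp [hφ, aeval_genPt]
    exact congrArg (fun h : MvPolynomial σ k →ₐ[k] _ => h a) this
  have hqT : ∀ j, (q j).eval₂ φ.toRingHom (Ideal.Quotient.mk I (X j)) = 0 := by
    intro j
    apply FaithfulSMul.algebraMap_injective (MvPolynomial τ k ⧸ I)
      (FractionRing (MvPolynomial τ k ⧸ I))
    rw [map_zero, Polynomial.hom_eval₂, ← hq j]
    congr 1
    ext a
    · exact hφL _
    · exact hφL _
  refine ⟨∏ j, (q j).leadingCoeff, Finset.prod_ne_zero_iff.2 fun j _ =>
    Polynomial.leadingCoeff_ne_zero.2 (hq0 j), fun w hw => ⟨?_, ?_⟩⟩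
  · have hlead : ∀ j, (q j).map (aeval w : MvPolynomial σ k →ₐ[k] k).toRingHom ≠ 0 := by
      intro j h0
      rw [map_prod, Finset.prod_ne_zero_iff] at hw
      apply hw j (Finset.mem_univ j)
      have := congrArg (fun p => p.coeff (q j).natDegree) h0
      simpa using this
    refine Set.Finite.subset (Set.Finite.pi (t := fun j =>
      {c : k | ((q j).map (aeval w : MvPolynomial σ k →ₐ[k] k).toRingHom).IsRoot c})
      fun j => Polynomial.finite_setOfPred_isRoot (hlead j)) ?_
    rintro x ⟨hx, hxz⟩ j -
    change Polynomial.eval _ _ = 0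
    rw [Polynomial.eval_map]
    let ev : MvPolynomial τ k ⧸ I →ₐ[k] k := Ideal.Quotient.liftₐ I (aeval x) hx
    have h1 := congrArg ev (hqT j)
    rw [map_zero] at h1
    rw [← h1]
    have h2 := Polynomial.hom_eval₂ (q j) φ.toRingHom ev.toRingHom (Ideal.Quotient.mk I (X j))
    refine Eq.trans ?_ h2.symm
    have e1 : ev.toRingHom (Ideal.Quotient.mk I (X j)) = x j := by
      change aeval x (X j) = x j
      simp
    rw [e1]
    congr 1
    ext a
    · simp
    · have : ev.toRingHom (φ.toRingHom (X a)) = aeval x (z a) := by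
        simp [hφ]
        rfl
      simp only [RingHom.comp_apply]
      rw [this, hxz a]
      simp
  · have hfint : ∀ j, φ.toRingHom.IsIntegralElem
        (φ (∏ j, (q j).leadingCoeff) * Ideal.Quotient.mk I (X j)) := by
      classical
      intro j
      rw [← Finset.mul_prod_erase _ _ (Finset.mem_univ j), map_mul, mul_right_comm]
      refine RingHom.IsIntegralElem.mul _ ?_ ?_
      · exact RingHom.isIntegralElem_leadingCoeff_mul φ.toRingHom (q j) _ (hqT j)
      · exact RingHom.isIntegralElem_map φ.toRingHom
    obtain ⟨x, hx, hxz⟩ := exists_point_of_integral I z (by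
      intro a b hab
      have := congrArg (algebraMap (MvPolynomial τ k ⧸ I)
        (FractionRing (MvPolynomial τ k ⧸ I))) hab
      rw [hφL, hφL] at this
      exact hind this) _ hfint w hw
    exact ⟨x, hx, hxz⟩

end Fibres

section Derivations

open TensorProduct

/-- Derivations extend along formally étale algebras. -/
theorem exists_derivation_of_formallyEtale {R S T : Type} [CommRing R] [CommRing S] [CommRing T]
    [Algebra R S] [Algebra R T] [Algebra S T] [IsScalarTower R S T] [Algebra.FormallyEtale S T]
    (D : Derivation R S T) : ∃ D' : Derivation R T T, ∀ s, D' (algebraMap S T s) = D s := by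
  let l : Ω[T⁄R] →ₗ[T] T := (D.liftKaehlerDifferential.liftBaseChange T).comp
    (KaehlerDifferential.tensorKaehlerEquivOfFormallyEtale R S T).symm.toLinearMap
  refine ⟨l.compDer (KaehlerDifferential.D R T), fun s => ?_⟩
  change (D.liftKaehlerDifferential.liftBaseChange T)
    ((KaehlerDifferential.tensorKaehlerEquivOfFormallyEtale R S T).symm
      (KaehlerDifferential.D R T (algebraMap S T s))) = _
  rw [KaehlerDifferential.tensorKaehlerEquivOfFormallyEtale_symm_D_algebraMap]
  simp

theorem exists_derivation_of_isTranscendenceBasis {k L ι : Type} [Field k] [CharZero k] [Field L]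
    [Algebra k L] {z : ι → L} (hz : IsTranscendenceBasis k z) (δ : ι → L) :
    ∃ D : Derivation k L L, ∀ i, D (z i) = δ i := by
  have hinj : Function.Injective (aeval z : MvPolynomial ι k →ₐ[k] L) := hz.1
  have halg := hz.isAlgebraic
  let _ : Algebra (MvPolynomial ι k) L := (aeval z : MvPolynomial ι k →ₐ[k] L).toAlgebra
  have : IsScalarTower k (MvPolynomial ι k) L :=
    IsScalarTower.of_algebraMap_eq fun c => ((aeval z).commutes c).symm
  have : FaithfulSMul (MvPolynomial ι k) L := (faithfulSMul_iff_algebraMap_injective _ _).2 hinj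
  let F := FractionRing (MvPolynomial ι k)
  let _ : Algebra F L := FractionRing.liftAlgebra _ _
  have : IsScalarTower (MvPolynomial ι k) F L := FractionRing.isScalarTower_liftAlgebra _ _
  have : Algebra.IsAlgebraic (MvPolynomial ι k) L := by
    refine ⟨fun y => ?_⟩
    obtain ⟨q, hq, hqy⟩ := exists_poly_of_isAlgebraic hz.1 (halg.1 y)
    exact ⟨q, hq, hqy⟩
  have : Algebra.IsAlgebraic F L :=
    (IsFractionRing.comap_isAlgebraic_iff (A := MvPolynomial ι k)).1 this
  have : CharZero F := charZero_of_injective_algebraMap (algebraMap k F).injective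
  have : Algebra.FormallyEtale F L := Algebra.FormallyEtale.of_isSeparable F L
  have : Algebra.FormallyEtale (MvPolynomial ι k) F :=
    Algebra.FormallyEtale.of_isLocalization (nonZeroDivisors (MvPolynomial ι k))
  have : Algebra.FormallyEtale (MvPolynomial ι k) L :=
    Algebra.FormallyEtale.comp (MvPolynomial ι k) F L
  obtain ⟨D, hD⟩ := exists_derivation_of_formallyEtale (mkDerivation k δ)
  refine ⟨D, fun i => ?_⟩
  have := hD (X i)
  rw [mkDerivation_X] at this
  rw [← this]
  congr 1
  exact (aeval_X z i).symm

theorem exists_derivation {k L ι : Type} [Field k] [CharZero k] [Field L]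
    [Algebra k L] {z : ι → L} (hz : AlgebraicIndependent k z) (δ : ι → L) :
    ∃ D : Derivation k L L, ∀ i, D (z i) = δ i := by
  classical
  obtain ⟨t, hst, ht⟩ := exists_isTranscendenceBasis_superset hz.coe_range
  obtain ⟨D, hD⟩ := exists_derivation_of_isTranscendenceBasis ht
    fun y : t => if h : ∃ i, z i = y then δ h.choose else 0
  refine ⟨D, fun i => ?_⟩
  rw [hD ⟨z i, hst ⟨i, rfl⟩⟩]
  have h : ∃ j, z j = z i := ⟨i, rfl⟩
  rw [dif_pos h, hz.injective h.choose_spec]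

/-- A derivation killing `S` kills everything algebraic over `S`. -/
theorem derivation_eq_zero {k L : Type} [Field k] [CharZero k] [Field L]
    [Algebra k L] {S : Set L} (D : Derivation k L L) (hS : ∀ s ∈ S, D s = 0) {y : L}
    (hy : IsAlgebraic (Algebra.adjoin k S) y) : D y = 0 := by
  have hA : ∀ a ∈ Algebra.adjoin k S, D a = 0 := by
    intro a ha
    induction ha using Algebra.adjoin_induction with
    | mem x hx => exact hS x hx
    | algebraMap r => exact D.map_algebraMap r
    | add x y _ _ hx hy => rw [map_add, hx, hy, add_zero]
    | mul x y _ _ hx hy => rw [D.leibniz, hx, hy, smul_zero, smul_zero, add_zero]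
  have : CharZero L := charZero_of_injective_algebraMap (algebraMap k L).injective
  let D' : Derivation (Algebra.adjoin k S) L L := Derivation.mk'
    { toFun := D
      map_add' := D.map_add
      map_smul' := fun a b => by
        rw [Algebra.smul_def, D.leibniz, RingHom.id_apply, Algebra.smul_def]
        rw [show D (algebraMap (Algebra.adjoin k S) L a) = 0 from hA _ a.2]
        rw [smul_zero, add_zero]
        rfl }
    fun a b => D.leibniz a b
  have key : ∀ (n : ℕ) (p : Polynomial (Algebra.adjoin k S)), p.natDegree = n → p ≠ 0 →
      Polynomial.aeval y p = 0 → D y = 0 := by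
    intro n
    induction n using Nat.strong_induction_on with
    | _ n ih =>
      intro p hn hp hpy
      have h1 : D' (Polynomial.aeval y p) = Polynomial.aeval y p.derivative • D y :=
        D'.map_aeval p y
      rw [hpy, map_zero] at h1
      rcases smul_eq_zero.1 h1.symm with h | h
      · have hn0 : p.natDegree ≠ 0 := by
          intro h0
          rw [Polynomial.eq_C_of_natDegree_eq_zero h0] at hp hpy
          rw [Polynomial.aeval_C] at hpy
          rw [(FaithfulSMul.algebraMap_eq_zero_iff (Algebra.adjoin k S) L).1 hpy] at hp
          simp at hp
        exact ih _ (by rw [← hn]; exact Polynomial.natDegree_derivative_lt hn0) _ rfl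
          (fun h0 => hn0 (Polynomial.derivative_eq_zero.1 h0)) h
      · exact h
  obtain ⟨p, hp, hpy⟩ := hy
  exact key _ p rfl hp hpy

/-- Evaluation of derivations at a tuple. -/
def derEval (k : Type) {L : Type} [Field k] [Field L] [Algebra k L] {σ : Type} (ξ : σ → L) :
    Derivation k L L →ₗ[L] (σ → L) where
  toFun D i := D (ξ i)
  map_add' _ _ := rfl
  map_smul' _ _ := rfl

theorem finrank_derEval_le {k L σ : Type} [Field k] [CharZero k] [Field L] [Algebra k L]
    (ξ : σ → L) {m : ℕ} (h : ark k (Set.range ξ) ≤ m) :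
    Module.finrank L (LinearMap.range (derEval k ξ)) ≤ m := by
  obtain ⟨B, hB⟩ := (AlgebraicIndependent.matroid k L).exists_isBasis (Set.range ξ) (by simp)
  have hcard : B.encard ≤ m := hB.encard_eq_eRk.trans_le h
  have hfin : B.Finite := Set.finite_of_encard_le_coe hcard
  have := hfin.fintype
  have hker : LinearMap.ker (derEval k (fun b : B => (b : L))) ≤ LinearMap.ker (derEval k ξ) := by
    intro D hD
    ext i
    refine derivation_eq_zero (S := B) D (fun s hs => congrFun hD ⟨s, hs⟩) ?_
    have := hB.subset_closure ⟨i, rfl⟩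
    rw [AlgebraicIndependent.matroid_closure_eq] at this
    exact this
  have hB' : Fintype.card B ≤ m := by
    rw [← Set.coe_fintypeCard] at hcard
    exact_mod_cast hcard
  have e1 := (derEval k ξ).quotKerEquivRange
  have e2 := (derEval k (fun b : B => (b : L))).quotKerEquivRange
  have := Module.Finite.equiv e2.symm
  have h1 := LinearMap.finrank_le_finrank_of_surjective (Submodule.factor_surjective hker)
  rw [← e1.finrank_eq]
  refine h1.trans ?_
  rw [e2.finrank_eq]
  refine (Submodule.finrank_le _).trans ?_
  rwa [Module.finrank_fintype_fun_eq_card]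

end Derivations

section Trisecant

theorem trisecant_aux {k L : Type} [Field k] [CharZero k] [Field L] [Algebra k L]
    (a b : Fin 4 → L) (α β : L) (hα : α ≠ 0) (hβ : β ≠ 0)
    (ha : ark k (Set.range a) ≤ (2 : ℕ)) (hb : ark k (Set.range b) ≤ (2 : ℕ))
    (hc : ark k (Set.range (α • a + β • b)) ≤ (2 : ℕ))
    (hz : AlgebraicIndependent k (a + b))
    (ha' : a ∈ LinearMap.range (derEval k a)) (hb' : b ∈ LinearMap.range (derEval k b))
    (hc' : α • a + β • b ∈ LinearMap.range (derEval k (α • a + β • b))) : False := by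
  have ha2 := finrank_derEval_le a ha
  have hb2 := finrank_derEval_le b hb
  have hc2 := finrank_derEval_le _ hc
  set A := LinearMap.range (derEval k a)
  set B := LinearMap.range (derEval k b)
  have hsurj : ∀ δ : Fin 4 → L, ∃ D : Derivation k L L, derEval k a D + derEval k b D = δ := by
    intro δ
    obtain ⟨D, hD⟩ := exists_derivation hz δ
    refine ⟨D, ?_⟩
    ext i
    rw [← hD i, Pi.add_apply, Pi.add_apply, map_add]
    rfl
  have hsup : A ⊔ B = ⊤ := by
    rw [eq_top_iff]
    intro δ _
    obtain ⟨D, rfl⟩ := hsurj δ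
    exact Submodule.add_mem_sup ⟨D, rfl⟩ ⟨D, rfl⟩
  have hdim := Submodule.finrank_sup_add_finrank_inf_eq A B
  rw [hsup, finrank_top, Module.finrank_fin_fun] at hdim
  have hinf : A ⊓ B = ⊥ := by
    rw [← Submodule.finrank_eq_zero (R := L)]
    omega
  have hA2 : Module.finrank L A = 2 := by omega
  have hB2 : Module.finrank L B = 2 := by omega
  have hnot : ∀ (W : Submodule L (Fin 4 → L)) (x : Fin 4 → L), Module.finrank L W = 2 →
      ∃ u ∈ W, u ∉ Submodule.span L {x} := by
    intro W x hW
    by_contra! hcon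
    have h1 := Submodule.finrank_mono (show W ≤ Submodule.span L {x} from hcon)
    have h2 := finrank_span_le_card (R := L) ({x} : Set (Fin 4 → L))
    simp at h2
    omega
  have ha0 : a ≠ 0 := by
    rintro rfl
    have : A = ⊥ := by
      rw [eq_bot_iff]
      rintro _ ⟨D, rfl⟩
      rw [Submodule.mem_bot]
      ext i
      exact D.map_zero
    rw [this] at hA2
    simp at hA2
  obtain ⟨u, huA, hu⟩ := hnot A a hA2
  obtain ⟨w, hwB, hw⟩ := hnot B b hB2
  have hzero : ∀ x ∈ A, ∀ y ∈ B, x + y = 0 → x = 0 ∧ y = 0 := by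
    intro x hx y hy hxy
    have h1 : x ∈ A ⊓ B := ⟨hx, by rw [eq_neg_of_add_eq_zero_left hxy]; exact B.neg_mem hy⟩
    rw [hinf, Submodule.mem_bot] at h1
    subst h1
    exact ⟨rfl, by simpa using hxy⟩
  obtain ⟨D, hD⟩ := hsurj u
  obtain ⟨D', hD'⟩ := hsurj w
  obtain ⟨hDa, hDb⟩ := hzero (derEval k a D - u) (A.sub_mem ⟨D, rfl⟩ huA) (derEval k b D) ⟨D, rfl⟩
    (by rw [← hD]; abel)
  obtain ⟨hDa', hDb'⟩ := hzero (derEval k a D') ⟨D', rfl⟩ (derEval k b D' - w)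
    (B.sub_mem ⟨D', rfl⟩ hwB) (by rw [← hD']; abel)
  rw [sub_eq_zero] at hDa hDb'
  have hev : ∀ E : Derivation k L L, derEval k (α • a + β • b) E =
      E α • a + α • derEval k a E + E β • b + β • derEval k b E := by
    intro E
    ext i
    simp [derEval]
    ring
  have hcD := hev D
  have hcD' := hev D'
  rw [hDa, hDb, smul_zero, add_zero] at hcD
  rw [hDa', hDb', smul_zero, add_zero] at hcD'
  have hlin : LinearIndependent L ![α • a + β • b, derEval k (α • a + β • b) D,
      derEval k (α • a + β • b) D'] := by
    rw [Fintype.linearIndependent_iff]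
    intro g hg
    simp only [Fin.sum_univ_three, Matrix.cons_val_zero, Matrix.cons_val_one, Matrix.cons_val] at hg
    rw [hcD, hcD'] at hg
    obtain ⟨h1, h2⟩ := hzero ((g 0 * α + g 1 * D α + g 2 * D' α) • a + (g 1 * α) • u)
      (A.add_mem (A.smul_mem _ ha') (A.smul_mem _ huA))
      ((g 0 * β + g 1 * D β + g 2 * D' β) • b + (g 2 * β) • w)
      (B.add_mem (B.smul_mem _ hb') (B.smul_mem _ hwB)) (by rw [← hg]; module)
    have key : ∀ (p q : L) (x y : Fin 4 → L), y ∉ Submodule.span L {x} → p • x + q • y = 0 →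
        q = 0 := by
      intro p q x y hy h
      by_contra hq
      apply hy
      rw [Submodule.mem_span_singleton]
      refine ⟨-(q⁻¹ * p), ?_⟩
      have : q⁻¹ • (p • x + q • y) = 0 := by rw [h, smul_zero]
      rw [smul_add, smul_smul, smul_smul, inv_mul_cancel₀ hq, one_smul] at this
      rw [neg_smul, eq_comm, ← sub_eq_zero, sub_neg_eq_add, add_comm]
      exact this
    have g1 : g 1 = 0 := by simpa [hα] using key _ _ _ _ hu h1
    have g2 : g 2 = 0 := by simpa [hβ] using key _ _ _ _ hw h2
    have g0 : g 0 = 0 := by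
      simpa [g1, g2, hα, ha0] using h1
    intro i
    fin_cases i
    · exact g0
    · exact g1
    · exact g2
  have hle : Submodule.span L (Set.range ![α • a + β • b, derEval k (α • a + β • b) D,
      derEval k (α • a + β • b) D']) ≤ LinearMap.range (derEval k (α • a + β • b)) := by
    rw [Submodule.span_le]
    rintro _ ⟨i, rfl⟩
    fin_cases i
    · exact hc'
    · exact ⟨D, rfl⟩
    · exact ⟨D', rfl⟩
  have h3 := Submodule.finrank_mono hle
  rw [finrank_span_eq_card hlin, Fintype.card_fin] at h3
  omega

/-- Closure of zeros under scaling. -/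
def ScaleInv {k σ : Type} [Field k] (I : Ideal (MvPolynomial σ k)) : Prop :=
  ∀ (L : Type) [Field L] [Algebra k L] (x : σ → L), (∀ f ∈ I, aeval x f = 0) →
    ∀ s : L, ∀ f ∈ I, aeval (s • x) f = 0

theorem trisecant_generic {k L : Type} [Field k] [CharZero k] [Field L] [Algebra k L]
    {I : Ideal (MvPolynomial (Fin 4) k)} (hI : ScaleInv I) (hr : RkLE I 2)
    (a b : Fin 4 → L) (l : L) (hl : l ≠ 0) (ha : ∀ f ∈ I, aeval a f = 0)
    (hb : ∀ f ∈ I, aeval b f = 0) (hc : ∀ f ∈ I, aeval (b + l • a) f = 0)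
    (hz : AlgebraicIndependent k (a + b)) : False := by
  have : CharZero L := charZero_of_injective_algebraMap (algebraMap k L).injective
  let P := MvPolynomial (Fin 3) L
  let L' := FractionRing P
  let y : Fin 3 → L' := fun i => algebraMap P L' (X i)
  have hy0 : ∀ i, y i ≠ 0 := fun i => by
    rw [Ne, FaithfulSMul.algebraMap_eq_zero_iff]
    exact X_ne_zero i
  have hyind : AlgebraicIndependent L y := by
    rw [algebraicIndependent_iff]
    intro p hp
    have : aeval y p = algebraMap P L' p := by
      have : (aeval y : P →ₐ[L] L') = IsScalarTower.toAlgHom L P L' := by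
        ext i
        rw [aeval_X]
        rfl
      rw [this]; rfl
    rwa [this, FaithfulSMul.algebraMap_eq_zero_iff] at hp
  let ι : L →ₐ[k] L' := IsScalarTower.toAlgHom k L L'
  have hup : ∀ x : Fin 4 → L, (∀ f ∈ I, aeval x f = 0) →
      ∀ f ∈ I, aeval (fun i => ι (x i)) f = 0 := by
    intro x hx f hf
    have : aeval (fun i => ι (x i)) f = ι (aeval x f) := by
      rw [← AlgHom.comp_apply, comp_aeval]
    rw [this, hx f hf, map_zero]
  let a' : Fin 4 → L' := fun i => ι (a i)
  let b' : Fin 4 → L' := fun i => ι (b i)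
  have hder : ∀ i, ∃ D : Derivation k L' L', (∀ j, D (y j) = if j = i then y i else 0) ∧
      ∀ c, D (ι c) = 0 := by
    intro i
    obtain ⟨D, hD⟩ := exists_derivation hyind fun j => if j = i then y i else 0
    exact ⟨D.restrictScalars k, hD, fun c => D.map_algebraMap c⟩
  choose D hD hDι using hder
  have hc2 : (y 2 * ι l * (y 0)⁻¹) • y 0 • a' + (y 2 * (y 1)⁻¹) • y 1 • b' =
      y 2 • (fun i => ι ((b + l • a) i)) := by
    ext i
    simp only [a', b', Pi.add_apply, Pi.smul_apply, smul_eq_mul, map_add, map_mul]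
    linear_combination (y 2 * ι l * ι (a i)) * inv_mul_cancel₀ (hy0 0) +
      (y 2 * ι (b i)) * inv_mul_cancel₀ (hy0 1)
  have hmem : ∀ (i : Fin 3) (x : Fin 4 → L),
      y i • (fun j => ι (x j)) ∈ LinearMap.range (derEval k (y i • (fun j => ι (x j)))) := by
    intro i x
    refine ⟨D i, ?_⟩
    ext j
    simp [derEval, hDι, hD]
    ring
  refine trisecant_aux (k := k) (y 0 • a') (y 1 • b') (y 2 * ι l * (y 0)⁻¹) (y 2 * (y 1)⁻¹)
    ?_ ?_ ?_ ?_ ?_ ?_ (hmem 0 a) (hmem 1 b) ?_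
  · refine mul_ne_zero (mul_ne_zero (hy0 2) ?_) (inv_ne_zero (hy0 0))
    rwa [Ne, map_eq_zero]
  · exact mul_ne_zero (hy0 2) (inv_ne_zero (hy0 1))
  · exact hr _ _ (hI _ _ (hup a ha) _)
  · exact hr _ _ (hI _ _ (hup b hb) _)
  · rw [hc2]
    exact hr _ _ (hI _ _ (hup _ hc) _)
  · rw [algebraicIndependent_iff]
    intro p hp
    rw [algebraicIndependent_iff] at hz
    apply hz
    let z' : Fin 4 → P := fun i => X 0 * C (a i) + X 1 * C (b i)
    have h1 : aeval (y 0 • a' + y 1 • b') p = algebraMap P L' (aeval z' p) := by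
      have := congrArg (fun h : MvPolynomial (Fin 4) k →ₐ[k] L' => h p)
        (comp_aeval (R := k) z' (IsScalarTower.toAlgHom k P L'))
      refine Eq.trans ?_ this.symm
      congr 2
      funext i
      change y 0 * ι (a i) + y 1 * ι (b i) =
        algebraMap P L' (X 0 * C (a i) + X 1 * C (b i))
      rw [map_add, map_mul, map_mul]
      rfl
    rw [h1, FaithfulSMul.algebraMap_eq_zero_iff] at hp
    have h2 := congrArg (aeval (fun _ => (1 : L)) : P →ₐ[L] L) hp
    rw [map_zero] at h2
    rw [← h2]
    have := congrArg (fun h : MvPolynomial (Fin 4) k →ₐ[k] L => h p)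
        (comp_aeval (R := k) z' ((aeval (fun _ => (1 : L)) : P →ₐ[L] L).restrictScalars k))
    refine Eq.trans ?_ this.symm
    congr 2
    funext i
    change a i + b i = aeval (fun _ => (1 : L))
      (X 0 * C (a i) + X 1 * C (b i) : MvPolynomial (Fin 3) L)
    simp
  · rw [hc2]
    exact hmem 2 _

end Trisecant

section Homog

variable {k : Type} [Field k]

theorem aeval_smul_of_isHomogeneous {σ S : Type} [CommRing S] [Algebra k S] {n : ℕ}
    {f : MvPolynomial σ k} (hf : f.IsHomogeneous n) (s : S) (x : σ → S) :
    aeval (s • x) f = s ^ n * aeval x f := by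
  rw [aeval_def, aeval_def, eval₂_eq, eval₂_eq, Finset.mul_sum]
  refine Finset.sum_congr rfl fun d hd => ?_
  have hdeg := hf (mem_support_iff.1 hd)
  have : ∏ i ∈ d.support, (s • x) i ^ d i = s ^ n * ∏ i ∈ d.support, x i ^ d i := by
    simp only [Pi.smul_apply, smul_eq_mul, mul_pow]
    rw [Finset.prod_mul_distrib, Finset.prod_pow_eq_pow_sum, ← hdeg]
    congr 2
    simp [Finsupp.weight_apply, Finsupp.sum]
  rw [this]
  ring

theorem aeval_smul_eq_sum {σ S : Type} [CommRing S] [Algebra k S]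
    (f : MvPolynomial σ k) (s : S) (x : σ → S) :
    aeval (s • x) f = ∑ n ∈ Finset.range (f.totalDegree + 1),
      s ^ n * aeval x (homogeneousComponent n f) := by
  conv_lhs => rw [← sum_homogeneousComponent f]
  rw [map_sum]
  exact Finset.sum_congr rfl fun n _ =>
    aeval_smul_of_isHomogeneous (homogeneousComponent_isHomogeneous n f) s x

theorem homogeneousComponent_mem_vanishingIdeal [Infinite k] {σ : Type} {Y : Set (σ → k)}
    (hY : ∀ w ∈ Y, ∀ t : k, t • w ∈ Y) {f : MvPolynomial σ k} (hf : f ∈ vanishingIdeal k Y)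
    (n : ℕ) : homogeneousComponent n f ∈ vanishingIdeal k Y := by
  intro w hw
  by_cases hn : f.totalDegree < n
  · rw [homogeneousComponent_eq_zero _ _ hn, map_zero]
  let p : Polynomial k := ∑ n ∈ Finset.range (f.totalDegree + 1),
    Polynomial.monomial n (aeval w (homogeneousComponent n f))
  have hp : p = 0 := by
    apply Polynomial.funext
    intro t
    rw [Polynomial.eval_zero, ← hf _ (hY w hw t), aeval_smul_eq_sum, Polynomial.eval_finsetSum]
    refine Finset.sum_congr rfl fun n _ => ?_
    rw [Polynomial.eval_monomial, mul_comm]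
  have := congrArg (fun q => Polynomial.coeff q n) hp
  simp only [p, Polynomial.finsetSum_coeff, Polynomial.coeff_monomial, Polynomial.coeff_zero,
    Finset.sum_ite_eq', Finset.mem_range] at this
  rwa [if_pos (by omega)] at this

theorem scaleInv_vanishingIdeal [Infinite k] {σ : Type} {Y : Set (σ → k)}
    (hY : ∀ w ∈ Y, ∀ t : k, t • w ∈ Y) : ScaleInv (vanishingIdeal k Y) := by
  intro L _ _ x hx s f hf
  rw [aeval_smul_eq_sum]
  refine Finset.sum_eq_zero fun n _ => ?_
  rw [hx _ (homogeneousComponent_mem_vanishingIdeal hY hf n), mul_zero]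

theorem no_trisecant [CharZero k] {K : Set (Fin 4 → k)}
    (hcone : ∀ w ∈ K, ∀ t : k, t • w ∈ K) (hr : RkLE (vanishingIdeal k K) 2) :
    ∃ f : MvPolynomial (Fin 4) k, f ≠ 0 ∧ ∀ a ∈ K, ∀ b ∈ K, ∀ l : k, l ≠ 0 →
      aeval (a + b) f ≠ 0 → b + l • a ∉ K := by
  by_contra! hcon
  let τ := (Fin 4 ⊕ Fin 4) ⊕ Bool
  let R := MvPolynomial τ k
  let A : Fin 4 → R := fun i => X (Sum.inl (Sum.inl i))
  let B : Fin 4 → R := fun i => X (Sum.inl (Sum.inr i))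
  let l : R := X (Sum.inr true)
  let m : R := X (Sum.inr false)
  let M : Set (τ → k) := {x | (fun i => aeval x (A i)) ∈ K ∧ (fun i => aeval x (B i)) ∈ K ∧
    aeval x (l * m) = 1 ∧ (fun i => aeval x ((B + l • A) i)) ∈ K}
  let z : MvPolynomial (Fin 4) k →ₐ[k] R := aeval (A + B)
  have hz : ∀ (x : τ → k) (f : MvPolynomial (Fin 4) k), aeval x (z f) =
      aeval ((fun i => aeval x (A i)) + fun i => aeval x (B i)) f := by
    intro x f
    rw [← AlgHom.comp_apply, comp_aeval]
    congr 2
    funext i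
    simp
  have hdisj : Disjoint (vanishingIdeal k M : Set R)
      ((nonZeroDivisors (MvPolynomial (Fin 4) k)).map z) := by
    rw [Set.disjoint_left]
    rintro _ h1 ⟨f, hf, rfl⟩
    obtain ⟨a, ha, b, hb, t, ht, hne, hc⟩ := hcon f (nonZeroDivisors.ne_zero hf)
    apply hne
    let x : τ → k := Sum.elim (Sum.elim a b) (fun c => if c then t else t⁻¹)
    have hxA : (fun i => aeval x (A i)) = a := by funext i; simp [A, x]
    have hxB : (fun i => aeval x (B i)) = b := by funext i; simp [B, x]
    have hxl : aeval x l = t := by simp [l, x]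
    have hxm : aeval x m = t⁻¹ := by simp [m, x]
    have hxM : x ∈ M := by
      refine ⟨by rwa [hxA], by rwa [hxB], ?_, ?_⟩
      · rw [map_mul, hxl, hxm, mul_inv_cancel₀ ht]
      · convert hc using 1
        funext i
        rw [Pi.add_apply, map_add, Pi.smul_apply, smul_eq_mul, map_mul, hxl, Pi.add_apply,
          Pi.smul_apply, smul_eq_mul, ← hxA, ← hxB]
    have := h1 x hxM
    rwa [hz, hxA, hxB] at this
  obtain ⟨Q, hQ, hle, hQd⟩ := Ideal.exists_le_prime_disjoint _ _ hdisj
  have hgen : ∀ (G : Fin 4 → R), (∀ x ∈ M, (fun i => aeval x (G i)) ∈ K) →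
      ∀ f ∈ vanishingIdeal k K, aeval (fun i => aeval (genPt Q) (G i)) f = 0 := by
    intro G hG f hf
    have h1 : aeval (genPt Q) (aeval G f) = 0 := by
      rw [aeval_genPt_eq_zero]
      apply hle
      intro x hx
      rw [← AlgHom.comp_apply, comp_aeval]
      exact hf _ (hG x hx)
    rwa [← AlgHom.comp_apply, comp_aeval] at h1
  have hl : aeval (genPt Q) l ≠ 0 := by
    intro h0
    have h1 : l * m - 1 ∈ Q := hle fun x hx => by rw [map_sub, hx.2.2.1, map_one, sub_self]
    rw [← aeval_genPt_eq_zero, map_sub, map_mul, h0, zero_mul, map_one, zero_sub] at h1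
    exact neg_ne_zero.2 one_ne_zero h1
  refine trisecant_generic (scaleInv_vanishingIdeal hcone) hr (fun i => aeval (genPt Q) (A i))
    (fun i => aeval (genPt Q) (B i)) _ hl (hgen A fun x hx => hx.1) (hgen B fun x hx => hx.2.1)
    ?_ ?_
  · have e : (fun i => aeval (genPt Q) (B i)) +
        aeval (genPt Q) l • (fun i => aeval (genPt Q) (A i)) =
        fun i => aeval (genPt Q) ((B + l • A) i) := by
      funext i
      rw [Pi.add_apply, Pi.add_apply, map_add, Pi.smul_apply, Pi.smul_apply, smul_eq_mul,
        smul_eq_mul, map_mul]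
    rw [e]
    exact hgen (B + l • A) fun x hx => hx.2.2.2
  · rw [algebraicIndependent_iff]
    intro f hf
    by_contra hf0
    have h1 : aeval (genPt Q) (z f) = 0 := by
      rw [← hf, ← AlgHom.comp_apply, comp_aeval]
      congr 2
      funext i
      simp
    rw [aeval_genPt_eq_zero] at h1
    exact Set.disjoint_left.1 hQd h1 ⟨f, mem_nonZeroDivisors_of_ne_zero hf0, rfl⟩

theorem finite_add_fibres [IsAlgClosed k] {K : Set (Fin 4 → k)} (hirr : Irr K) (hcl : ZClosed K)
    (h0 : (0 : Fin 4 → k) ∈ K) (hcone : ∀ w ∈ K, ∀ t : k, t • w ∈ K)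
    (hspan : Submodule.span k K = ⊤) (hne : K ≠ Set.univ) (hr : RkLE (vanishingIdeal k K) 2) :
    ∃ f : MvPolynomial (Fin 4) k, f ≠ 0 ∧ ∀ h : Fin 4 → k, aeval h f ≠ 0 →
      {a | a ∈ K ∧ h - a ∈ K}.Finite ∧ {a | a ∈ K ∧ h - a ∈ K}.Nonempty := by
  let M : Set (Fin 4 ⊕ Fin 4 → k) :=
    {w | (fun i => w (Sum.inl i)) ∈ K ∧ (fun i => w (Sum.inr i)) ∈ K}
  let I := vanishingIdeal k M
  have hI : I.IsPrime := hirr.prod hirr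
  let z : Fin 4 → MvPolynomial (Fin 4 ⊕ Fin 4) k := fun i => X (Sum.inl i) + X (Sum.inr i)
  have hzl : zeroLocus k I = M := by
    refine Set.Subset.antisymm (fun x hx => ⟨hcl _ fun f hf => ?_, hcl _ fun f hf => ?_⟩)
      (fun x hx f hf => hf x hx)
    · have h1 : (rename Sum.inl f : MvPolynomial (Fin 4 ⊕ Fin 4) k) ∈ I := by
        intro w hw
        rw [aeval_rename]
        exact hf _ hw.1
      have := hx _ h1
      rwa [aeval_rename] at this
    · have h1 : (rename Sum.inr f : MvPolynomial (Fin 4 ⊕ Fin 4) k) ∈ I := by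
        intro w hw
        rw [aeval_rename]
        exact hf _ hw.2
      have := hx _ h1
      rwa [aeval_rename] at this
  have hdom := add_dominant hirr hcl h0 hcone hspan hne
  have hind : AlgebraicIndependent k fun i => aeval (genPt I) (z i) := by
    rw [algebraicIndependent_iff]
    intro f hf
    have h1 : aeval (genPt I) (aeval z f) = 0 := by
      rw [← hf, ← AlgHom.comp_apply, comp_aeval]
    rw [aeval_genPt_eq_zero] at h1
    have h2 : f ∈ vanishingIdeal k {w | ∃ a ∈ K, ∃ b ∈ K, w = a + b} := by
      rintro _ ⟨a, ha, b, hb, rfl⟩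
      have := h1 (Sum.elim a b) ⟨ha, hb⟩
      rw [← AlgHom.comp_apply, comp_aeval] at this
      rw [← this]
      congr 2
      funext i
      simp [z]
    rwa [hdom, Ideal.mem_bot] at h2
  have hrk : RkLE I (Nat.card (Fin 4)) := by
    intro L _ _ x hx
    have e : Set.range x =
          Set.range (fun i => x (Sum.inl i)) ∪ Set.range (fun i => x (Sum.inr i)) := by
      ext y
      simp
    rw [e]
    refine (ark_union_le _ _).trans ?_
    have h1 := hr L (fun i => x (Sum.inl i)) fun f hf => by
      have h1 : (rename Sum.inl f : MvPolynomial (Fin 4 ⊕ Fin 4) k) ∈ I := by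
        intro w hw
        rw [aeval_rename]
        exact hf _ hw.1
      have := hx _ h1
      rwa [aeval_rename] at this
    have h2 := hr L (fun i => x (Sum.inr i)) fun f hf => by
      have h1 : (rename Sum.inr f : MvPolynomial (Fin 4 ⊕ Fin 4) k) ∈ I := by
        intro w hw
        rw [aeval_rename]
        exact hf _ hw.2
      have := hx _ h1
      rwa [aeval_rename] at this
    refine (add_le_add h1 h2).trans ?_
    simp
    norm_num
  obtain ⟨f, hf, hfib⟩ := finite_fibres I z hind hrk
  refine ⟨f, hf, fun h hh => ?_⟩
  obtain ⟨h1, h2⟩ := hfib h hh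
  rw [hzl] at h1 h2
  have hiff : {a | a ∈ K ∧ h - a ∈ K} = (fun (x : Fin 4 ⊕ Fin 4 → k) i => x (Sum.inl i)) ''
      {x | x ∈ M ∧ ∀ i, aeval x (z i) = h i} := by
    ext a
    constructor
    · rintro ⟨ha, hb⟩
      refine ⟨Sum.elim a (h - a), ⟨⟨ha, hb⟩, fun i => by simp [z]⟩, rfl⟩
    · rintro ⟨x, ⟨hx, hxz⟩, rfl⟩
      refine ⟨hx.1, ?_⟩
      convert hx.2 using 1
      funext i
      have := hxz i
      simp only [z, map_add, aeval_X] at this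
      rw [Pi.sub_apply, ← this]
      ring
  rw [hiff]
  exact ⟨h1.image _, h2.image _⟩

end Homog

section Projective

open EL Projectivization

variable {k : Type} [Field k] {n : ℕ}

/-- The affine cone over a set of projective points, including the origin. -/
def cn (S : Set (PS k n)) : Set (Fin n → k) :=
  {w | ∀ h : w ≠ 0, Projectivization.mk k w h ∈ S}

theorem mem_cn {S : Set (PS k n)} {w : Fin n → k} (hw : w ≠ 0) :
    w ∈ cn S ↔ Projectivization.mk k w hw ∈ S := ⟨fun h => h hw, fun h _ => h⟩

theorem zero_mem_cn (S : Set (PS k n)) : (0 : Fin n → k) ∈ cn S := fun h => (h rfl).elim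

theorem mk_smul {t : k} {w : Fin n → k} (h : t • w ≠ 0) (hw : w ≠ 0) :
    Projectivization.mk k (t • w) h = Projectivization.mk k w hw :=
  (mk_eq_mk_iff' k _ _ h hw).2 ⟨t, rfl⟩

theorem smul_mem_cn {S : Set (PS k n)} (w : Fin n → k) (hw : w ∈ cn S) (t : k) :
    t • w ∈ cn S := by
  intro h
  have hw0 : w ≠ 0 := by rintro rfl; simp at h
  rw [mk_smul h hw0]
  exact hw hw0

theorem mk_mem_V0 {f : MvPolynomial (Fin n) k} {d : ℕ} (hf : f.IsHomogeneous d)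
    {w : Fin n → k} (hw : w ≠ 0) : Projectivization.mk k w hw ∈ V0 f ↔ aeval w f = 0 := by
  constructor
  · intro h
    exact h w hw rfl
  · intro h u hu heq
    obtain ⟨t, rfl⟩ := (mk_eq_mk_iff' k _ _ hu hw).1 heq
    change aeval (t • w) f = 0
    rw [aeval_smul_of_isHomogeneous hf, h, mul_zero]

theorem isOpen_compl_V0 {f : MvPolynomial (Fin n) k} {d : ℕ} (hf : f.IsHomogeneous d) :
    IsOpen (V0 f)ᶜ := TopologicalSpace.isOpen_generateFrom_of_mem ⟨d, f, hf, rfl⟩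

theorem exists_poly_of_isOpen {U : Set (PS k n)} (hU : IsOpen U) {w : Fin n → k} (hw : w ≠ 0)
    (hmem : Projectivization.mk k w hw ∈ U) :
    ∃ (d : ℕ) (f : MvPolynomial (Fin n) k), f.IsHomogeneous d ∧ aeval w f ≠ 0 ∧
      ∀ (u : Fin n → k) (hu : u ≠ 0), aeval u f ≠ 0 → Projectivization.mk k u hu ∈ U := by
  induction hU with
  | basic s hs =>
    obtain ⟨d, f, hf, rfl⟩ := hs
    exact ⟨d, f, hf, fun h => hmem ((mk_mem_V0 hf hw).2 h),
      fun u hu h h' => h ((mk_mem_V0 hf hu).1 h')⟩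
  | univ => exact ⟨0, 1, isHomogeneous_one _ _, by rw [map_one]; exact one_ne_zero,
      fun _ _ _ => trivial⟩
  | inter s t _ _ ih1 ih2 =>
    obtain ⟨d, f, hf, h1, h2⟩ := ih1 hmem.1
    obtain ⟨e, g, hg, h3, h4⟩ := ih2 hmem.2
    refine ⟨d + e, f * g, hf.mul hg, by rw [map_mul]; exact mul_ne_zero h1 h3,
      fun u hu h => ?_⟩
    rw [map_mul] at h
    exact ⟨h2 u hu (left_ne_zero_of_mul h), h4 u hu (right_ne_zero_of_mul h)⟩
  | sUnion S _ ih =>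
    obtain ⟨s, hs, hm⟩ := hmem
    obtain ⟨d, f, hf, h1, h2⟩ := ih s hs hm
    exact ⟨d, f, hf, h1, fun u hu h => ⟨s, hs, h2 u hu h⟩⟩

theorem exists_coord {w : Fin n → k} (hw : w ≠ 0) :
    ∃ j, aeval w (X j : MvPolynomial (Fin n) k) ≠ 0 := by
  obtain ⟨j, hj⟩ := Function.ne_iff.1 hw
  exact ⟨j, by rw [aeval_X]; exact hj⟩

theorem ne_zero_of_coord {w : Fin n → k} {j : Fin n}
    (h : aeval w (X j : MvPolynomial (Fin n) k) ≠ 0) : w ≠ 0 := by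
  rintro rfl
  simp at h

theorem exists_poly_of_notMem_closure {S : Set (PS k n)} {w : Fin n → k} (hw : w ≠ 0)
    (h : Projectivization.mk k w hw ∉ closure S) :
    ∃ (d : ℕ) (f : MvPolynomial (Fin n) k), f.IsHomogeneous d ∧ aeval w f ≠ 0 ∧
      ∀ u ∈ cn S, aeval u f = 0 := by
  obtain ⟨d, f, hf, h1, h2⟩ := exists_poly_of_isOpen isClosed_closure.isOpen_compl hw h
  obtain ⟨j, hj⟩ := exists_coord hw
  refine ⟨d + 1, f * X j, hf.mul (isHomogeneous_X k j),
    by rw [map_mul]; exact mul_ne_zero h1 hj, fun u hu => ?_⟩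
  by_contra hne
  rw [map_mul] at hne
  have hu0 := ne_zero_of_coord (right_ne_zero_of_mul hne)
  exact h2 u hu0 (left_ne_zero_of_mul hne) (subset_closure (hu hu0))

theorem isClosed_of_poly {S : Set (PS k n)}
    (h : ∀ (w : Fin n → k) (hw : w ≠ 0), Projectivization.mk k w hw ∉ S →
      ∃ (d : ℕ) (f : MvPolynomial (Fin n) k), f.IsHomogeneous d ∧ aeval w f ≠ 0 ∧
        ∀ u ∈ cn S, aeval u f = 0) : IsClosed S := by
  rw [← isOpen_compl_iff, isOpen_iff_forall_mem_open]
  intro p hp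
  induction p using Projectivization.ind with
  | h w hw =>
    obtain ⟨d, f, hf, h1, h2⟩ := h w hw hp
    refine ⟨_, ?_, isOpen_compl_V0 hf, fun h' => h1 ((mk_mem_V0 hf hw).1 h')⟩
    intro p hp' hpS
    induction p using Projectivization.ind with
    | h u hu => exact hp' ((mk_mem_V0 hf hu).2 (h2 u ((mem_cn hu).2 hpS)))

theorem zclosed_cn {S : Set (PS k n)} (hS : IsClosed S) : ZClosed (cn S) := by
  intro w hw hw0
  by_contra h
  rw [← hS.closure_eq] at h
  obtain ⟨d, f, -, h1, h2⟩ := exists_poly_of_notMem_closure hw0 h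
  exact h1 (hw f h2)

theorem exists_on_line [Infinite k] {f : MvPolynomial (Fin n) k} {i : ℕ} {w : Fin n → k}
    (h : aeval w (homogeneousComponent i f) ≠ 0) :
    ∃ y ∈ {y : Fin n → k | ∃ t : k, y = t • w}, aeval y f ≠ 0 := by
  by_contra! hcon
  refine h (homogeneousComponent_mem_vanishingIdeal
    (Y := {y : Fin n → k | ∃ t : k, y = t • w}) ?_ hcon i w ⟨1, (one_smul k w).symm⟩)
  rintro _ ⟨t, rfl⟩ s
  exact ⟨s * t, (mul_smul s t w).symm⟩

theorem exists_component [Infinite k] {S : Set (PS k n)} (hS : S.Nonempty)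
    {f : MvPolynomial (Fin n) k} (hf : ∃ y ∈ cn S, aeval y f ≠ 0) :
    ∃ (i : ℕ) (w : Fin n → k) (hw : w ≠ 0), Projectivization.mk k w hw ∈ S ∧
      aeval w (homogeneousComponent i f) ≠ 0 := by
  obtain ⟨y, hy, hfy⟩ := hf
  have key : ∃ y ∈ cn S, y ≠ 0 ∧ aeval y f ≠ 0 := by
    by_cases hy0 : y = 0
    · obtain ⟨p, hp⟩ := hS
      have hr : p.rep ∈ cn S := by
        rw [mem_cn p.rep_nonzero, p.mk_rep]; exact hp
      obtain ⟨j, hj⟩ := exists_coord p.rep_nonzero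
      obtain ⟨_, ⟨t, rfl⟩, h1, h2⟩ := (irr_iff.1 (irr_line p.rep)).2 f (X j)
        ⟨0, ⟨0, by simp⟩, hy0 ▸ hfy⟩ ⟨p.rep, ⟨1, by simp⟩, hj⟩
      exact ⟨_, smul_mem_cn _ hr t, ne_zero_of_coord h2, h1⟩
    · exact ⟨y, hy, hy0, hfy⟩
  obtain ⟨y, hy, hy0, hfy⟩ := key
  rw [← sum_homogeneousComponent f, map_sum] at hfy
  obtain ⟨i, -, hi⟩ := Finset.exists_ne_zero_of_sum_ne_zero hfy
  exact ⟨i, y, hy0, hy hy0, hi⟩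

theorem irr_cn [Infinite k] {S : Set (PS k n)} (hS : IsIrreducible S) : Irr (cn S) := by
  rw [irr_iff]
  refine ⟨⟨0, zero_mem_cn S⟩, fun f g hf hg => ?_⟩
  obtain ⟨i, w1, hw1, hm1, h1⟩ := exists_component hS.1 hf
  obtain ⟨j, w2, hw2, hm2, h2⟩ := exists_component hS.1 hg
  have hi := homogeneousComponent_isHomogeneous i f
  have hj := homogeneousComponent_isHomogeneous j g
  obtain ⟨p, hpS, hp1, hp2⟩ := hS.2 _ _ (isOpen_compl_V0 hi) (isOpen_compl_V0 hj)
    ⟨_, hm1, fun h => h1 ((mk_mem_V0 hi hw1).1 h)⟩ ⟨_, hm2, fun h => h2 ((mk_mem_V0 hj hw2).1 h)⟩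
  induction p using Projectivization.ind with
  | h w hw =>
    obtain ⟨_, ⟨t, rfl⟩, ha, hb⟩ := (irr_iff.1 (irr_line w)).2 f g
      (exists_on_line fun h => hp1 ((mk_mem_V0 hi hw).2 h))
      (exists_on_line fun h => hp2 ((mk_mem_V0 hj hw).2 h))
    exact ⟨_, smul_mem_cn w ((mem_cn hw).2 hpS) t, ha, hb⟩

/-- The projective points represented by a set of vectors. -/
def pts (Y : Set (Fin n → k)) : Set (PS k n) :=
  {p | ∃ w ∈ Y, ∃ h : w ≠ 0, p = Projectivization.mk k w h}

theorem isIrreducible_pts {Y : Set (Fin n → k)} (hY : Irr Y) (h0 : ∃ w ∈ Y, w ≠ 0) :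
    IsIrreducible (pts Y) := by
  obtain ⟨w, hw, hw0⟩ := h0
  refine ⟨⟨_, w, hw, hw0, rfl⟩, ?_⟩
  rintro U V hU hV ⟨_, ⟨a, ha, ha0, rfl⟩, haU⟩ ⟨_, ⟨b, hb, hb0, rfl⟩, hbV⟩
  obtain ⟨d, f, hf, hf1, hf2⟩ := exists_poly_of_isOpen hU ha0 haU
  obtain ⟨e, g, hg, hg1, hg2⟩ := exists_poly_of_isOpen hV hb0 hbV
  obtain ⟨j, hj⟩ := exists_coord ha0
  obtain ⟨y, hy, h1, h2⟩ := (irr_iff.1 hY).2 (f * X j) g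
    ⟨a, ha, by rw [map_mul]; exact mul_ne_zero hf1 hj⟩ ⟨b, hb, hg1⟩
  rw [map_mul] at h1
  have hy0 := ne_zero_of_coord (right_ne_zero_of_mul h1)
  exact ⟨_, ⟨y, hy, hy0, rfl⟩, hf2 y hy0 (left_ne_zero_of_mul h1), hg2 y hy0 h2⟩

theorem generic_of_poly [Infinite k] {P : PS k n → Prop} {F : MvPolynomial (Fin n) k}
    (hF : F ≠ 0) (h : ∀ (w : Fin n → k) (hw : w ≠ 0), aeval w F ≠ 0 →
      P (Projectivization.mk k w hw)) : Generic P := by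
  have : ∃ i, homogeneousComponent i F ≠ 0 := by
    by_contra! hcon
    apply hF
    rw [← sum_homogeneousComponent F]
    exact Finset.sum_eq_zero fun i _ => hcon i
  obtain ⟨i, hi⟩ := this
  have hh := homogeneousComponent_isHomogeneous i F
  refine ⟨_, isOpen_compl_V0 hh, ?_, ?_⟩
  · rw [dense_iff_inter_open]
    rintro U hU ⟨p, hp⟩
    induction p using Projectivization.ind with
    | h w hw =>
      obtain ⟨d, f, hf, hf1, hf2⟩ := exists_poly_of_isOpen hU hw hp
      obtain ⟨j, hj⟩ := exists_coord hw
      have hex : ∃ y ∈ (Set.univ : Set (Fin n → k)), aeval y (homogeneousComponent i F) ≠ 0 := by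
        by_contra! hcon
        exact hi (MvPolynomial.funext fun x => by
          rw [map_zero]; exact hcon x trivial)
      obtain ⟨y, -, h1, h2⟩ := (irr_iff.1 irr_univ).2 (f * X j) _
        ⟨w, trivial, by rw [map_mul]; exact mul_ne_zero hf1 hj⟩ hex
      rw [map_mul] at h1
      have hy0 := ne_zero_of_coord (right_ne_zero_of_mul h1)
      exact ⟨_, hf2 y hy0 (left_ne_zero_of_mul h1), fun h' => h2 ((mk_mem_V0 hh hy0).1 h')⟩
  · intro p hp
    induction p using Projectivization.ind with
    | h w hw =>
      obtain ⟨j, hj⟩ := exists_coord hw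
      obtain ⟨_, ⟨t, rfl⟩, h1, h2⟩ := (irr_iff.1 (irr_line w)).2 F (X j)
        (exists_on_line fun h' => hp ((mk_mem_V0 hh hw).2 h')) ⟨w, ⟨1, by simp⟩, hj⟩
      have h0 := ne_zero_of_coord h2
      rw [← mk_smul h0 hw]
      exact h _ h0 h1

theorem mk_submodule_le {w : Fin n → k} (hw : w ≠ 0) {W : Submodule k (Fin n → k)} :
    (Projectivization.mk k w hw).submodule ≤ W ↔ w ∈ W := by
  rw [submodule_mk, Submodule.span_singleton_le_iff_mem]

theorem mk_mem_linSet {w : Fin n → k} (hw : w ≠ 0) {W : Submodule k (Fin n → k)} :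
    Projectivization.mk k w hw ∈ linSet W ↔ w ∈ W := mk_submodule_le hw

theorem isClosed_linSet (W : Submodule k (Fin n → k)) : IsClosed (linSet W) := by
  refine isClosed_of_poly fun w hw h => ?_
  rw [mk_mem_linSet] at h
  obtain ⟨φ, h1, h2⟩ := Submodule.exists_le_ker_of_notMem h
  refine ⟨1, linPoly φ, linPoly_isHomogeneous φ, by rwa [aeval_linPoly], fun u hu => ?_⟩
  rw [aeval_linPoly]
  by_cases hu0 : u = 0
  · rw [hu0, map_zero]
  · exact h2 ((mk_mem_linSet hu0).1 (hu hu0))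

theorem exists_poly_of_genericIn {W : Submodule k (Fin n → k)} (hW : W ≠ ⊥)
    {P : PS k n → Prop} (h : GenericIn (linSet W) P) :
    ∃ f : MvPolynomial (Fin n) k, (∃ w ∈ W, aeval w f ≠ 0) ∧
      ∀ w ∈ W, ∀ hw : w ≠ 0, aeval w f ≠ 0 → P (Projectivization.mk k w hw) := by
  obtain ⟨U, hU, hcl, hP⟩ := h
  obtain ⟨w0, hw0, hne⟩ := Submodule.exists_mem_ne_zero_of_ne_bot hW
  have : (linSet W ∩ U).Nonempty := by
    rw [← closure_nonempty_iff]
    exact ⟨_, hcl ((mk_mem_linSet hne).2 hw0)⟩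
  obtain ⟨p, hpW, hpU⟩ := this
  induction p using Projectivization.ind with
  | h w hw =>
    obtain ⟨d, f, -, hf1, hf2⟩ := exists_poly_of_isOpen hU hw hpU
    exact ⟨f, ⟨w, (mk_mem_linSet hw).1 hpW, hf1⟩,
      fun u hu hu0 h => hP _ ⟨(mk_mem_linSet hu0).2 hu, hf2 u hu0 h⟩⟩

end Projective

section Homogenize

variable {k : Type} [Field k] {σ : Type}

/-- Homogenization of a polynomial with respect to the `i`-th coordinate. -/
def homogenize (i : σ) (f : MvPolynomial σ k) : MvPolynomial σ k :=
  ∑ e ∈ Finset.range (f.totalDegree + 1), X i ^ (f.totalDegree - e) * homogeneousComponent e f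

theorem homogenize_isHomogeneous (i : σ) (f : MvPolynomial σ k) :
    (homogenize i f).IsHomogeneous f.totalDegree := by
  refine IsHomogeneous.sum _ _ _ fun e he => ?_
  have := ((isHomogeneous_X k i).pow (f.totalDegree - e)).mul
    (homogeneousComponent_isHomogeneous e f)
  convert this using 1
  rw [Finset.mem_range] at he
  omega

theorem aeval_homogenize {L : Type} [Field L] [Algebra k L] (i : σ) (f : MvPolynomial σ k)
    {y : σ → L} (hy : y i ≠ 0) :
    aeval y (homogenize i f) = y i ^ f.totalDegree * aeval ((y i)⁻¹ • y) f := by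
  rw [aeval_smul_eq_sum, homogenize, map_sum, Finset.mul_sum]
  refine Finset.sum_congr rfl fun e he => ?_
  rw [Finset.mem_range] at he
  rw [map_mul, map_pow, aeval_X, ← mul_assoc]
  congr 1
  have : f.totalDegree = (f.totalDegree - e) + e := by omega
  conv_rhs => rw [this]
  rw [pow_add, mul_assoc, ← mul_pow, mul_inv_cancel₀ hy, one_pow, mul_one]

theorem irr_slice {K : Set (σ → k)} (hirr : Irr K) (hcone : ∀ w ∈ K, ∀ t : k, t • w ∈ K)
    {i : σ} (hi : ∃ y ∈ K, y i ≠ 0) : Irr {y | y ∈ K ∧ y i = 1} := by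
  rw [irr_iff] at hirr ⊢
  constructor
  · obtain ⟨y, hy, hyi⟩ := hi
    exact ⟨(y i)⁻¹ • y, hcone y hy _, by simp [hyi]⟩
  · rintro f g ⟨a, ⟨ha, hai⟩, hfa⟩ ⟨b, ⟨hb, hbi⟩, hgb⟩
    have key : ∀ (f : MvPolynomial σ k) (a : σ → k), a i = 1 →
        aeval a f ≠ 0 → aeval a (X i * homogenize i f) ≠ 0 := by
      intro f a hai h
      rw [map_mul, aeval_X, hai, one_mul, aeval_homogenize i f (by rw [hai]; exact one_ne_zero),
        hai, one_pow, one_mul, inv_one, one_smul]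
      exact h
    obtain ⟨y, hy, h1, h2⟩ := hirr.2 (X i * homogenize i f) (X i * homogenize i g)
      ⟨a, ha, key f a hai hfa⟩ ⟨b, hb, key g b hbi hgb⟩
    rw [map_mul, aeval_X] at h1 h2
    have hyi := left_ne_zero_of_mul h1
    have h1 := right_ne_zero_of_mul h1
    have h2 := right_ne_zero_of_mul h2
    rw [aeval_homogenize i _ hyi] at h1 h2
    exact ⟨(y i)⁻¹ • y, ⟨hcone y hy _, by simp [hyi]⟩, right_ne_zero_of_mul h1,
      right_ne_zero_of_mul h2⟩

theorem zclosed_slice {K : Set (σ → k)} (hcl : ZClosed K) (i : σ) :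
    ZClosed {y | y ∈ K ∧ y i = 1} := by
  refine fun w hw => ⟨hcl w fun f hf => hw f fun x hx => hf x hx.1, ?_⟩
  have := hw (X i - 1) fun x hx => by simp [hx.2]
  simpa [sub_eq_zero] using this

theorem rkLE_of_slice {K : Set (σ → k)} (hirr : Irr K)
    (hcone : ∀ w ∈ K, ∀ t : k, t • w ∈ K) {i : σ} (hi : ∃ y ∈ K, y i ≠ 0) {m : ℕ}
    (hr : RkLE (vanishingIdeal k {y | y ∈ K ∧ y i = 1}) m) :
    RkLE (vanishingIdeal k K) (m + 1) := by
  have hprime : (vanishingIdeal k K).IsPrime := hirr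
  let ξ := genPt (vanishingIdeal k K)
  refine rkLE_of_generic ξ (fun f => (aeval_genPt_eq_zero _ f).1) ?_
  have hξi : ξ i ≠ 0 := by
    intro h
    obtain ⟨y, hy, hyi⟩ := hi
    have : (X i : MvPolynomial σ k) ∈ vanishingIdeal k K := by
      rw [← aeval_genPt_eq_zero, aeval_X]; exact h
    have := this y hy
    rw [aeval_X] at this
    exact hyi this
  let ζ := (ξ i)⁻¹ • ξ
  have hζ : ∀ f ∈ vanishingIdeal k {y | y ∈ K ∧ y i = 1}, aeval ζ f = 0 := by
    intro f hf
    have hG : X i * homogenize i f ∈ vanishingIdeal k K := by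
      intro y hy
      rw [map_mul, aeval_X]
      by_cases hyi : y i = 0
      · rw [hyi, zero_mul]
      · rw [aeval_homogenize i f hyi, hf _ ⟨hcone y hy _, by simp [hyi]⟩, mul_zero, mul_zero]
    rw [← aeval_genPt_eq_zero, map_mul, aeval_X] at hG
    have hG := (mul_eq_zero.1 hG).resolve_left hξi
    rw [aeval_homogenize i f hξi] at hG
    exact (mul_eq_zero.1 hG).resolve_left (pow_ne_zero _ hξi)
  calc ark k (Set.range ξ) ≤ ark k (Set.range ζ ∪ {ξ i}) := by
        refine ark_le_of_algebraic ?_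
        rintro _ ⟨j, rfl⟩
        have h1 : ξ i ∈ Algebra.adjoin k (Set.range ζ ∪ {ξ i}) :=
          Algebra.subset_adjoin (Or.inr rfl)
        have h2 : ζ j ∈ Algebra.adjoin k (Set.range ζ ∪ {ξ i}) :=
          Algebra.subset_adjoin (Or.inl ⟨j, rfl⟩)
        have h3 : ξ j = ξ i * ζ j := by
          simp only [ζ, Pi.smul_apply, smul_eq_mul]
          rw [mul_inv_cancel_left₀ hξi]
        rw [h3]
        exact isAlgebraic_algebraMap
          (⟨_, mul_mem h1 h2⟩ : Algebra.adjoin k (Set.range ζ ∪ {ξ i}))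
    _ ≤ ark k (Set.range ζ) + ark k {ξ i} := ark_union_le _ _
    _ ≤ m + 1 := add_le_add (hr _ ζ hζ) ((Matroid.eRk_le_encard _ _).trans (by simp))
    _ = ((m + 1 : ℕ) : ℕ∞) := by push_cast; rfl

end Homogenize

section Chains

open EL

variable {k : Type} [Field k] {n : ℕ}

theorem three_le_pdim {S : Set (PS k n)} {W : Fin 4 → Set (PS k n)}
    (hirr : ∀ j, IsIrreducible (W j)) (hcl : ∀ j, IsClosed (W j)) (hS : ∀ j, W j ⊆ S)
    (h01 : W 0 ⊂ W 1) (h12 : W 1 ⊂ W 2) (h23 : W 2 ⊂ W 3) : 3 ≤ pdim S := by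
  let V : Fin 4 → TopologicalSpace.IrreducibleCloseds ↥S := fun j =>
    { carrier := Subtype.val ⁻¹' (W j)
      isIrreducible' := by
        refine ⟨?_, ?_⟩
        · obtain ⟨w, hw⟩ := (hirr j).1
          exact ⟨⟨w, hS j hw⟩, hw⟩
        · rintro _ _ ⟨U₁, hU₁, rfl⟩ ⟨U₂, hU₂, rfl⟩ ⟨a, ha, ha'⟩ ⟨b, hb, hb'⟩
          obtain ⟨w, hw, hw'⟩ := (hirr j).2 U₁ U₂ hU₁ hU₂ ⟨a, ha, ha'⟩ ⟨b, hb, hb'⟩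
          exact ⟨⟨w, hS j hw⟩, hw, hw'⟩
      isClosed' := (hcl j).preimage continuous_subtype_val }
  have hlt : ∀ i j, W i ⊂ W j → V i < V j := by
    intro i j h
    rw [lt_iff_le_not_ge]
    refine ⟨fun x hx => h.1 hx, fun hle => h.2 fun x hx => ?_⟩
    have h' : (⟨x, hS j hx⟩ : ↥S) ∈ V i := hle (show (⟨x, hS j hx⟩ : ↥S) ∈ V j from hx)
    exact h'
  let s : LTSeries (TopologicalSpace.IrreducibleCloseds ↥S) :=
    { length := 3
      toFun := V
      step := by
        intro i
        fin_cases i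
        · exact hlt 0 1 h01
        · exact hlt 1 2 h12
        · exact hlt 2 3 h23 }
  exact Order.LTSeries.length_le_krullDim s

/-- The data of a linear projection from a point, with a linear section. -/
structure ProjData (v₀ : Fin 5 → k) (p : (Fin 5 → k) →ₗ[k] (Fin 4 → k))
    (σ : (Fin 4 → k) →ₗ[k] (Fin 5 → k)) : Prop where
  proj_sec : ∀ y, p (σ y) = y
  ker : ∀ w, p w = 0 ↔ ∃ c : k, w = c • v₀
  ne : v₀ ≠ 0

variable {v₀ : Fin 5 → k} {p : (Fin 5 → k) →ₗ[k] (Fin 4 → k)}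
  {σ : (Fin 4 → k) →ₗ[k] (Fin 5 → k)}

theorem ProjData.proj_vertex (h : ProjData v₀ p σ) : p v₀ = 0 := (h.ker v₀).2 ⟨1, by simp⟩

theorem ProjData.decompose (h : ProjData v₀ p σ) (w : Fin 5 → k) :
    ∃ c : k, w = σ (p w) + c • v₀ := by
  obtain ⟨c, hc⟩ := (h.ker (w - σ (p w))).1 (by rw [map_sub, h.proj_sec, sub_self])
  exact ⟨c, by rw [← hc]; abel⟩

theorem irr_preimage [Infinite k] (h : ProjData v₀ p σ) {Y : Set (Fin 4 → k)} (hY : Irr Y) :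
    Irr (p ⁻¹' Y) := by
  have := (hY.linImage σ).add (irr_line v₀)
  convert this using 1
  ext w
  constructor
  · intro hw
    obtain ⟨c, hc⟩ := h.decompose w
    exact ⟨_, ⟨_, hw, rfl⟩, _, ⟨c, rfl⟩, hc⟩
  · rintro ⟨_, ⟨y, hy, rfl⟩, _, ⟨c, rfl⟩, rfl⟩
    simpa [h.proj_sec, h.proj_vertex] using hy

theorem mem_of_mk_mem_closure {Y : Set (Fin 4 → k)} (hcl : ZClosed Y) {i : Fin 4}
    (hYi : ∀ y ∈ Y, y i = 1) {w : Fin 5 → k} (hw : w ≠ 0) (hwi : p w i = 1)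
    (hmem : Projectivization.mk k w hw ∈ closure (pts (p ⁻¹' Y))) : p w ∈ Y := by
  refine hcl _ fun f hf => ?_
  by_contra hne
  let F : MvPolynomial (Fin 5) k :=
    aeval (fun j => linPoly ((LinearMap.proj j).comp p)) (homogenize i f)
  have hFe : ∀ u, aeval u F = aeval (p u) (homogenize i f) := by
    intro u
    change aeval u (aeval _ _) = _
    rw [← AlgHom.comp_apply, comp_aeval]
    congr 2
    funext j
    rw [aeval_linPoly]
    rfl
  have hFh : F.IsHomogeneous (f.totalDegree) := by
    have := (homogenize_isHomogeneous i f).aeval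
      (fun j => linPoly ((LinearMap.proj j).comp p)) (fun j => linPoly_isHomogeneous _)
    rwa [one_mul] at this
  have hv : ∀ u, p u i = 1 → aeval u F = aeval (p u) f := by
    intro u hu
    rw [hFe, aeval_homogenize i f (by rw [hu]; exact one_ne_zero), hu]
    simp
  have hcl' : IsClosed (V0 F) := by
    rw [← isOpen_compl_iff]
    exact isOpen_compl_V0 hFh
  have hsub : pts (p ⁻¹' Y) ⊆ V0 F := by
    rintro _ ⟨u, hu, hu0, rfl⟩
    rw [mk_mem_V0 hFh, hv u (hYi _ hu)]
    exact hf _ hu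
  have := closure_minimal hsub hcl' hmem
  rw [mk_mem_V0 hFh, hv w hwi] at this
  exact hne this

theorem rkLE_base [IsAlgClosed k] (h : ProjData v₀ p σ) {S : Set (PS k 5)}
    (hS : IsClosed S) (hdim : pdim S ≤ 2) {K : Set (Fin 4 → k)}
    (hK : ∀ w, w ∈ cn S ↔ p w ∈ K) (hirr : Irr K) (hcl : ZClosed K)
    (hcone : ∀ w ∈ K, ∀ t : k, t • w ∈ K) (hne : ∃ y ∈ K, y ≠ 0) :
    RkLE (vanishingIdeal k K) 2 := by
  have : Infinite k := IsAlgClosed.instInfinite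
  obtain ⟨y₀, hy₀, hy₀0⟩ := hne
  obtain ⟨i, hi⟩ := Function.ne_iff.1 hy₀0
  have hex : ∃ y ∈ K, y i ≠ 0 := ⟨y₀, hy₀, hi⟩
  refine rkLE_of_slice (m := 1) hirr hcone hex ?_
  let Z : Set (Fin 4 → k) := {y | y ∈ K ∧ y i = 1}
  have hZ : Irr Z := irr_slice hirr hcone hex
  have hZc : ZClosed Z := zclosed_slice hcl i
  have : (vanishingIdeal k Z).IsPrime := hZ
  refine rkLE_of_ringKrullDim_le (vanishingIdeal k Z) ?_
  refine iSup_le fun s => ?_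
  by_contra hlen
  have hlen : 2 ≤ s.length := by
    by_contra! hcon
    exact hlen (by
      have : s.length ≤ 1 := by omega
      exact_mod_cast this)
  let Q : Fin 3 → Ideal (MvPolynomial (Fin 4) k) := fun j =>
    (s ⟨j, by omega⟩).asIdeal.comap (Ideal.Quotient.mk (vanishingIdeal k Z))
  have hQp : ∀ j, (Q j).IsPrime := fun j => Ideal.IsPrime.comap _
  have hQle : ∀ j, vanishingIdeal k Z ≤ Q j := by
    intro j f hf
    rw [Ideal.mem_comap, Ideal.Quotient.eq_zero_iff_mem.2 hf]
    exact zero_mem _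
  have hQlt : ∀ a b : Fin 3, a < b → Q a < Q b := by
    intro a b hab
    have h1 := s.strictMono (show (⟨a, by omega⟩ : Fin (s.length + 1)) < ⟨b, by omega⟩ from hab)
    rw [lt_iff_le_not_ge] at h1 ⊢
    exact ⟨Ideal.comap_mono h1.1,
      fun hh => h1.2
        ((Ideal.comap_le_comap_iff_of_surjective _ Ideal.Quotient.mk_surjective _ _).1 hh)⟩
  let Y : Fin 3 → Set (Fin 4 → k) := fun j => zeroLocus k (Q j)
  have hIY : ∀ j, vanishingIdeal k (Y j) = Q j := fun j =>
    IsPrime.vanishingIdeal_zeroLocus (Q j)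
  have hYirr : ∀ j, Irr (Y j) := fun j => by
    unfold Irr; rw [hIY]; exact hQp j
  have hYcl : ∀ j, ZClosed (Y j) := fun j w hw f hf => hw f (by rw [hIY]; exact hf)
  have hYZ : ∀ j, Y j ⊆ Z := fun j w hw => hZc w fun f hf => hw f (hQle j hf)
  have hYle : ∀ a b : Fin 3, a < b → Y b ⊆ Y a := fun a b hab =>
    zeroLocus_anti_mono (hQlt a b hab).le
  have hYne : ∀ a b : Fin 3, a < b → ∃ y ∈ Y a, y ∉ Y b := by
    intro a b hab
    by_contra! hcon
    have : Y a = Y b := Set.Subset.antisymm hcon (hYle a b hab)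
    have h2 := hQlt a b hab
    rw [← hIY a, ← hIY b, this] at h2
    exact lt_irrefl _ h2
  have hσ0 : ∀ y ∈ Z, σ y ≠ 0 := by
    intro y hy h0
    have : y = 0 := by rw [← h.proj_sec y, h0, map_zero]
    have h1 := hy.2
    rw [this] at h1
    exact zero_ne_one h1
  let A : Fin 3 → Set (PS k 5) := fun j => closure (pts (p ⁻¹' (Y j)))
  have hAirr : ∀ j, IsIrreducible (A j) := by
    intro j
    obtain ⟨y, hy⟩ := (irr_iff.1 (hYirr j)).1
    exact (isIrreducible_pts (irr_preimage h (hYirr j))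
      ⟨σ y, by rwa [Set.mem_preimage, h.proj_sec], hσ0 y (hYZ j hy)⟩).closure
  have hAS : ∀ j, A j ⊆ S := by
    intro j
    refine closure_minimal ?_ hS
    rintro _ ⟨w, hw, hw0, rfl⟩
    exact (mem_cn hw0).1 ((hK w).2 (hYZ j hw).1)
  have hAmem : ∀ (j) (y : Fin 4 → k) (hy : y ∈ Y j),
      Projectivization.mk k (σ y) (hσ0 y (hYZ j hy)) ∈ A j := fun j y hy =>
    subset_closure ⟨σ y, by rwa [Set.mem_preimage, h.proj_sec], hσ0 y (hYZ j hy), rfl⟩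
  have hAlt : ∀ a b : Fin 3, a < b → A b ⊂ A a := by
    intro a b hab
    refine ⟨closure_mono ?_, fun hsub => ?_⟩
    · rintro _ ⟨w, hw, hw0, rfl⟩
      exact ⟨w, hYle a b hab hw, hw0, rfl⟩
    · obtain ⟨y, hy, hyb⟩ := hYne a b hab
      have := mem_of_mk_mem_closure (hYcl b) (fun y hy => (hYZ b hy).2) (hσ0 y (hYZ a hy))
        (by rw [h.proj_sec]; exact (hYZ a hy).2) (hsub (hAmem a y hy))
      rw [h.proj_sec] at this
      exact hyb this
  obtain ⟨y₂, hy₂⟩ := (irr_iff.1 (hYirr 2)).1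
  have hs0 := hσ0 y₂ (hYZ 2 hy₂)
  have hB1 : IsIrreducible (closure (pts {σ y₂})) :=
    (isIrreducible_pts (irr_singleton _) ⟨_, rfl, hs0⟩).closure
  have hB2 : closure (pts {σ y₂}) ⊂ A 2 := by
    refine ⟨closure_mono ?_, fun hsub => ?_⟩
    · rintro _ ⟨_, rfl, hw0, rfl⟩
      exact ⟨σ y₂, by rwa [Set.mem_preimage, h.proj_sec], hw0, rfl⟩
    · have hp : p (σ y₂ + v₀) = y₂ := by rw [map_add, h.proj_sec, h.proj_vertex, add_zero]
      have hn0 : σ y₂ + v₀ ≠ 0 := by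
        intro h0
        have : y₂ = 0 := by rw [← hp, h0, map_zero]
        have h1 := (hYZ 2 hy₂).2
        rw [this] at h1
        exact zero_ne_one h1
      have h1 : Projectivization.mk k _ hn0 ∈ A 2 :=
        subset_closure ⟨_, by rwa [Set.mem_preimage, hp], hn0, rfl⟩
      have h2 := closure_minimal (t := linSet (Submodule.span k {σ y₂})) (by
        rintro _ ⟨_, rfl, hw0, rfl⟩
        exact (mk_mem_linSet hw0).2 (Submodule.mem_span_singleton_self _))
        (isClosed_linSet _) (hsub h1)
      rw [mk_mem_linSet] at h2
      obtain ⟨t, ht⟩ := Submodule.mem_span_singleton.1 h2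
      have h3 : t • y₂ = y₂ := by
        have := congrArg p ht
        rwa [map_smul, h.proj_sec, hp] at this
      have ht1 : t = 1 := by
        have := congrFun h3 i
        rwa [Pi.smul_apply, (hYZ 2 hy₂).2, smul_eq_mul, mul_one] at this
      rw [ht1, one_smul] at ht
      exact h.ne (left_eq_add.1 ht)
  have := three_le_pdim (S := S) (W := ![closure (pts {σ y₂}), A 2, A 1, A 0])
    (by intro j; fin_cases j
        exacts [hB1, hAirr 2, hAirr 1, hAirr 0])
    (by intro j; fin_cases j <;> exact isClosed_closure)
    (by intro j; fin_cases j
        exacts [hB2.1.trans (hAS 2), hAS 2, hAS 1, hAS 0])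
    hB2 (hAlt 1 2 (by decide)) (hAlt 0 1 (by decide))
  have h32 : (3 : WithBot ℕ∞) ≤ 2 := this.trans hdim
  exact absurd h32 (by decide)

end Chains

section Setup

open EL

variable {k : Type} [Field k]

theorem exists_projData {v₀ : Fin 5 → k} (φ : (Fin 5 → k) →ₗ[k] k) (hφ : φ v₀ ≠ 0) :
    ∃ (p : (Fin 5 → k) →ₗ[k] (Fin 4 → k)) (σ : (Fin 4 → k) →ₗ[k] (Fin 5 → k)),
      ProjData v₀ p σ ∧ LinearMap.range σ = LinearMap.ker φ := by
  have hv : v₀ ≠ 0 := by rintro rfl; simp at hφ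
  have hsurj : LinearMap.range φ = ⊤ := by
    rw [LinearMap.range_eq_top]
    intro c
    exact ⟨(c / φ v₀) • v₀, by rw [map_smul, smul_eq_mul, div_mul_cancel₀ _ hφ]⟩
  have hfr : Module.finrank k (Fin 4 → k) = Module.finrank k (LinearMap.ker φ) := by
    have := LinearMap.finrank_range_add_finrank_ker φ
    rw [hsurj, finrank_top, Module.finrank_self, Module.finrank_fin_fun] at this
    rw [Module.finrank_fin_fun]
    omega
  let e := LinearEquiv.ofFinrankEq _ _ hfr
  let π : (Fin 5 → k) →ₗ[k] LinearMap.ker φ :=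
    LinearMap.codRestrict _ (LinearMap.id - (φ v₀)⁻¹ • LinearMap.smulRight φ v₀) (by
      intro w
      rw [LinearMap.mem_ker]
      simp only [LinearMap.sub_apply, LinearMap.id_apply, LinearMap.smul_apply,
        LinearMap.smulRight_apply, map_sub, map_smul, smul_eq_mul]
      field_simp
      ring)
  have hπ : ∀ w, (π w : Fin 5 → k) = w - (φ v₀)⁻¹ • φ w • v₀ := fun w => rfl
  have hπk : ∀ x : LinearMap.ker φ, π (x : Fin 5 → k) = x := by
    intro x
    apply Subtype.ext
    rw [hπ, LinearMap.mem_ker.1 x.2, zero_smul, smul_zero, sub_zero]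
  refine ⟨e.symm.toLinearMap.comp π, (LinearMap.ker φ).subtype.comp e.toLinearMap,
    ⟨fun y => ?_, fun w => ?_, hv⟩, ?_⟩
  · simp [hπk]
  · simp only [LinearMap.comp_apply, LinearEquiv.coe_coe, LinearEquiv.map_eq_zero_iff]
    constructor
    · intro h
      have := congrArg Subtype.val h
      rw [hπ] at this
      exact ⟨(φ v₀)⁻¹ * φ w, by rw [mul_smul]; exact sub_eq_zero.1 this⟩
    · rintro ⟨c, rfl⟩
      apply Subtype.ext
      rw [hπ, map_smul, smul_smul, smul_eq_mul, mul_comm c, inv_mul_cancel_left₀ hφ, sub_self]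
      rfl
  · rw [LinearMap.range_comp, LinearEquiv.range, Submodule.map_top, Submodule.range_subtype]

/-- A cone in projective 4-space written as the preimage of an affine cone `K`
under the projection from the vertex. -/
structure ConeData (S : Set (PS k 5)) (v₀ : Fin 5 → k) (p : (Fin 5 → k) →ₗ[k] (Fin 4 → k))
    (σ : (Fin 4 → k) →ₗ[k] (Fin 5 → k)) (K : Set (Fin 4 → k)) : Prop where
  proj : ProjData v₀ p σ
  mem : ∀ w, w ∈ cn S ↔ p w ∈ K
  irr : Irr K
  zclosed : ZClosed K
  cone : ∀ w ∈ K, ∀ t : k, t • w ∈ K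
  zero_mem : (0 : Fin 4 → k) ∈ K
  span : Submodule.span k K = ⊤

theorem cn_add_vertex {S : Set (PS k 5)} (hS : S.Nonempty) {v : PS k 5} (hcone : IsCone S v)
    {w : Fin 5 → k} (hw : w ∈ cn S) (c : k) : w + c • v.rep ∈ cn S := by
  have hv : v.rep ∈ v.submodule := by
    rw [Projectivization.submodule_eq]; exact Submodule.mem_span_singleton_self _
  intro h0
  by_cases hw0 : w = 0
  · obtain ⟨x, hx⟩ := hS
    refine hcone x hx _ ?_
    rw [mk_submodule_le, hw0, zero_add]
    exact Submodule.mem_sup_left (Submodule.smul_mem _ _ hv)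
  · refine hcone _ (hw hw0) _ ?_
    rw [mk_submodule_le]
    refine add_mem (Submodule.mem_sup_right ?_)
      (Submodule.mem_sup_left (Submodule.smul_mem _ _ hv))
    rw [Projectivization.submodule_mk]
    exact Submodule.mem_span_singleton_self _

theorem coneData_of_isCone [Infinite k] {S : Set (PS k 5)} (hS : IsVariety S) (hnd : Nondeg S)
    {v : PS k 5} (hcone : IsCone S v) {p : (Fin 5 → k) →ₗ[k] (Fin 4 → k)}
    {σ : (Fin 4 → k) →ₗ[k] (Fin 5 → k)} (h : ProjData v.rep p σ) :
    ConeData S v.rep p σ (σ ⁻¹' (cn S)) := by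
  have hmem : ∀ w, w ∈ cn S ↔ p w ∈ σ ⁻¹' (cn S) := by
    intro w
    obtain ⟨c, hc⟩ := h.decompose w
    constructor
    · intro hw
      have := cn_add_vertex hS.2.1 hcone hw (-c)
      have e : w + (-c) • v.rep = σ (p w) := by
        conv_lhs => rw [hc]
        rw [neg_smul, add_neg_cancel_right]
      rwa [e] at this
    · intro hw
      rw [hc]
      exact cn_add_vertex hS.2.1 hcone hw c
  have himg : σ ⁻¹' (cn S) = p '' (cn S) := by
    ext y
    constructor
    · intro hy
      exact ⟨σ y, hy, h.proj_sec y⟩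
    · rintro ⟨w, hw, rfl⟩
      exact (hmem w).1 hw
  refine ⟨h, hmem, ?_, ?_, ?_, ?_, ?_⟩
  · rw [himg]
    exact (irr_cn hS.2).linImage p
  · intro y hy
    refine zclosed_cn hS.1 _ fun f hf => ?_
    have e : ∀ x, aeval x (bind₁ (fun j => linPoly ((LinearMap.proj j).comp σ)) f) =
        aeval (σ x) f := by
      intro x
      rw [aeval_bind₁]
      congr 2
      funext j
      rw [aeval_linPoly]
      rfl
    rw [← e]
    exact hy _ fun x hx => by rw [e]; exact hf _ hx
  · intro w hw t
    rw [Set.mem_preimage, map_smul]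
    exact smul_mem_cn _ hw t
  · rw [Set.mem_preimage, map_zero]
    exact zero_mem_cn S
  · rw [himg, Submodule.span_image]
    have h1 : Submodule.span k (cn S) = ⊤ := by
      rw [eq_top_iff, ← show pspan S = ⊤ from hnd]
      refine iSup₂_le fun x hx => ?_
      rw [Projectivization.submodule_eq, Submodule.span_singleton_le_iff_mem]
      refine Submodule.subset_span ?_
      rw [mem_cn x.rep_nonzero, x.mk_rep]
      exact hx
    rw [h1, Submodule.map_top, LinearMap.range_eq_top]
    exact fun y => ⟨σ y, h.proj_sec y⟩

theorem linSet_infinite [Infinite k] {n : ℕ} {W : Submodule k (Fin n → k)}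
    (hW : 1 < Module.finrank k W) : (linSet W).Infinite := by
  have : Nontrivial W := Module.nontrivial_of_finrank_pos (R := k) (by omega)
  obtain ⟨a, ha⟩ := exists_ne (0 : W)
  obtain ⟨b, hb⟩ := exists_linearIndependent_pair_of_one_lt_finrank hW ha
  rw [LinearIndependent.pair_iff] at hb
  have hne : ∀ t : k, (b : Fin n → k) + t • (a : Fin n → k) ≠ 0 := by
    intro t h0
    have := (hb t 1 (Subtype.ext (by
      rw [one_smul, add_comm]; exact h0))).2
    exact one_ne_zero this
  refine Set.infinite_of_injective_forall_mem
    (f := fun t : k => Projectivization.mk k _ (hne t)) ?_ ?_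
  · intro s t hst
    obtain ⟨u, hu⟩ := (Projectivization.mk_eq_mk_iff' k _ _ _ _).1 hst
    have := hb (u * t - s) (u - 1) (Subtype.ext (by
      have := sub_eq_zero.2 hu
      rw [Submodule.coe_zero, ← this]
      simp only [Submodule.coe_add, Submodule.coe_smul]
      module))
    have hu1 : u = 1 := sub_eq_zero.1 this.2
    have := sub_eq_zero.1 this.1
    rw [hu1, one_mul] at this
    exact this.symm
  · intro t
    rw [mk_mem_linSet]
    exact add_mem b.2 (W.smul_mem _ a.2)

end Setup

section Rank

open EL

variable {k : Type} [Field k] {n : ℕ}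

open Classical in
theorem pspan_pair (x y : PS k n) :
    pspan (↑({x, y} : Finset (PS k n)) : Set (PS k n)) = x.submodule ⊔ y.submodule := by
  rw [pspan, Finset.coe_insert, Finset.coe_singleton, iSup_insert, iSup_singleton]

theorem not_memSpan_of_card_le_one {S : Set (PS k n)} {q : PS k n} (hq : q ∉ S)
    {A : Finset (PS k n)} (hA : ↑A ⊆ S) (hc : A.card ≤ 1) : ¬ memSpan q ↑A := by
  intro h
  rw [memSpan, pspan] at h
  have hqs : q.rep ∈ q.submodule := by
    rw [Projectivization.submodule_eq]; exact Submodule.mem_span_singleton_self _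
  have : Nonempty (PS k n) := ⟨q⟩
  rcases Finset.card_le_one_iff_subset_singleton.1 hc with ⟨x, hx⟩
  have h2 : q.submodule ≤ x.submodule := h.trans (iSup₂_le fun y hy => by
    rw [Finset.mem_singleton.1 (hx hy)])
  have hqx : q = x := by
    have h3 := h2 hqs
    rw [Projectivization.submodule_eq] at h3
    obtain ⟨t, ht⟩ := Submodule.mem_span_singleton.1 h3
    rw [← q.mk_rep, ← x.mk_rep]
    exact (Projectivization.mk_eq_mk_iff' k _ _ _ _).2 ⟨t, ht⟩
  rcases Finset.subset_singleton_iff.1 hx with rfl | rfl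
  · have : q.submodule ≤ ⊥ := h.trans (iSup₂_le fun y hy => by simp at hy)
    exact q.rep_nonzero ((Submodule.mem_bot k).1 (this hqs))
  · exact hq (hqx ▸ hA (by simp))

/-- The summands of `w` in the affine cone over `S`. -/
def summands (S : Set (PS k n)) (w : Fin n → k) : Set (Fin n → k) :=
  {a | a ∈ cn S ∧ w - a ∈ cn S}

theorem summands_ne {S : Set (PS k n)} {w : Fin n → k} (hw : w ≠ 0)
    (hq : Projectivization.mk k w hw ∉ S) {a : Fin n → k} (ha : a ∈ summands S w) :
    ∃ (h1 : a ≠ 0) (h2 : w - a ≠ 0),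
      Projectivization.mk k a h1 ≠ Projectivization.mk k (w - a) h2 := by
  have h1 : a ≠ 0 := by
    rintro rfl
    have := ha.2
    rw [sub_zero] at this
    exact hq (this hw)
  have h2 : w - a ≠ 0 := by
    intro h
    rw [sub_eq_zero] at h
    have := ha.1
    rw [← h] at this
    exact hq (this hw)
  refine ⟨h1, h2, fun heq => ?_⟩
  obtain ⟨t, ht⟩ := (Projectivization.mk_eq_mk_iff' k _ _ _ _).1 heq
  have : w ∈ cn S := by
    have e : w = (t + 1) • (w - a) := by
      rw [add_smul, ht]; simp
    rw [e]
    exact smul_mem_cn _ ha.2 _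
  exact hq (this hw)

open Classical in
theorem decomps_eq {S : Set (PS k n)} {w : Fin n → k} (hw : w ≠ 0)
    (hq : Projectivization.mk k w hw ∉ S) (hne : (summands S w).Nonempty) :
    decomps S (Projectivization.mk k w hw) =
      {A | ∃ a ∈ summands S w, ∃ (h1 : a ≠ 0) (h2 : w - a ≠ 0),
        A = {Projectivization.mk k a h1, Projectivization.mk k (w - a) h2}} := by
  set q := Projectivization.mk k w hw with hqdef
  have key : ∀ a ∈ summands S w, ∀ (h1 : a ≠ 0) (h2 : w - a ≠ 0),
      (↑({Projectivization.mk k a h1, Projectivization.mk k (w - a) h2} : Finset (PS k n)) :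
        Set (PS k n)) ⊆ S ∧
      ({Projectivization.mk k a h1, Projectivization.mk k (w - a) h2} :
        Finset (PS k n)).card = 2 ∧
      memSpan q ↑({Projectivization.mk k a h1, Projectivization.mk k (w - a) h2} :
        Finset (PS k n)) := by
    intro a ha h1 h2
    obtain ⟨_, _, hneq⟩ := summands_ne hw hq ha
    refine ⟨?_, Finset.card_pair hneq, ?_⟩
    · intro x hx
      rw [Finset.coe_insert, Finset.coe_singleton] at hx
      rcases hx with rfl | hx
      · exact ha.1 h1
      · rw [Set.mem_singleton_iff.1 hx]
        exact ha.2 h2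
    · rw [memSpan, pspan_pair, hqdef, mk_submodule_le, Projectivization.submodule_mk,
        Projectivization.submodule_mk]
      have e : w = a + (w - a) := by abel
      rw [e]
      exact add_mem (Submodule.mem_sup_left (Submodule.mem_span_singleton_self _))
        (Submodule.mem_sup_right (by
          rw [← e]; exact Submodule.mem_span_singleton_self _))
  have hrk : rk S q = 2 := by
    obtain ⟨a, ha⟩ := hne
    obtain ⟨h1, h2, -⟩ := summands_ne hw hq ha
    obtain ⟨k1, k2, k3⟩ := key a ha h1 h2
    refine le_antisymm (Nat.sInf_le ⟨_, k1, k2, k3⟩) ?_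
    have := Nat.sInf_mem (s := {s | hasDecomp S q s}) ⟨2, _, k1, k2, k3⟩
    obtain ⟨A, hA1, hA2, hA3⟩ := this
    by_contra! hlt
    exact not_memSpan_of_card_le_one hq hA1 (by rw [hA2]; exact Nat.lt_succ_iff.1 hlt) hA3
  ext A
  constructor
  · rintro ⟨hAS, hAc, hAi⟩
    rw [hrk] at hAc
    obtain ⟨x, y, hxy, rfl⟩ := Finset.card_eq_two.1 hAc
    have hm := hAi.1
    rw [memSpan, pspan_pair, hqdef, mk_submodule_le, Projectivization.submodule_eq,
      Projectivization.submodule_eq, Submodule.mem_sup] at hm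
    obtain ⟨a, ha, b, hb, hab⟩ := hm
    obtain ⟨s, rfl⟩ := Submodule.mem_span_singleton.1 ha
    obtain ⟨t, rfl⟩ := Submodule.mem_span_singleton.1 hb
    have hx : x.rep ∈ cn S := by
      rw [mem_cn x.rep_nonzero, x.mk_rep]; exact hAS (by simp)
    have hy : y.rep ∈ cn S := by
      rw [mem_cn y.rep_nonzero, y.mk_rep]; exact hAS (by simp)
    have hb' : w - s • x.rep = t • y.rep := by rw [← hab]; abel
    have hmem : s • x.rep ∈ summands S w :=
      ⟨smul_mem_cn _ hx _, by rw [hb']; exact smul_mem_cn _ hy _⟩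
    obtain ⟨h1, h2, -⟩ := summands_ne hw hq hmem
    refine ⟨_, hmem, h1, h2, ?_⟩
    have e2 : Projectivization.mk k _ h2 = y := by
      conv_rhs => rw [← y.mk_rep]
      exact (Projectivization.mk_eq_mk_iff' k _ _ _ _).2 ⟨t, hb'.symm⟩
    rw [e2, mk_smul h1 x.rep_nonzero, x.mk_rep]
  · rintro ⟨a, ha, h1, h2, rfl⟩
    obtain ⟨k1, k2, k3⟩ := key a ha h1 h2
    refine ⟨k1, by rw [hrk, k2], k3, fun B hB => ?_⟩
    refine not_memSpan_of_card_le_one hq ((Finset.coe_subset.2 hB.1).trans k1) ?_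
    have := Finset.card_lt_card hB
    omega

theorem entryLocus_eq {S : Set (PS k n)} {w : Fin n → k} (hw : w ≠ 0)
    (hq : Projectivization.mk k w hw ∉ S) (hne : (summands S w).Nonempty) :
    entryLocus S (Projectivization.mk k w hw) = closure (pts (summands S w)) := by
  classical
  rw [entryLocus, decomps_eq hw hq hne]
  congr 1
  ext x
  simp only [Set.mem_iUnion]
  constructor
  · rintro ⟨A, ⟨a, ha, h1, h2, rfl⟩, hx⟩
    rw [Finset.coe_insert, Finset.coe_singleton] at hx
    rcases hx with rfl | hx
    · exact ⟨a, ha, h1, rfl⟩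
    · refine ⟨w - a, ⟨ha.2, ?_⟩, h2, hx⟩
      rw [sub_sub_cancel]
      exact ha.1
  · rintro ⟨a, ha, h1, rfl⟩
    obtain ⟨_, h2, -⟩ := summands_ne hw hq ha
    exact ⟨_, ⟨a, ha, h1, h2, rfl⟩, by simp⟩

end Rank

section Degree

open EL

variable {k : Type} [Field k]

theorem exists_ne_zero_of_hyperplane [IsAlgClosed k] {n : ℕ} {K : Set (Fin n → k)}
    (hirr : Irr K) (hcl : ZClosed K) (hcone : ∀ w ∈ K, ∀ t : k, t • w ∈ K)
    {q : Fin n → k} (hqK : q ∈ K) (hq0 : q ≠ 0)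
    (hq : ¬ K ⊆ {w | ∃ t : k, w = t • q}) (l : (Fin n → k) →ₗ[k] k) :
    ∃ y ∈ K, y ≠ 0 ∧ l y = 0 := by
  by_contra! hcon
  have : Infinite k := IsAlgClosed.instInfinite
  let P := vanishingIdeal k K
  let Q := vanishingIdeal k {w : Fin n → k | ∃ t : k, w = t • q}
  let M := vanishingIdeal k {(0 : Fin n → k)}
  have hP : P.IsPrime := hirr
  have hQ : Q.IsPrime := irr_line q
  have hM : M.IsPrime := irr_singleton 0
  have hPQ : P < Q := vanishingIdeal_lt (by rintro _ ⟨t, rfl⟩; exact hcone q hqK t)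
    (zclosed_line q) hq
  have hQM : Q < M := vanishingIdeal_lt (by rintro _ rfl; exact ⟨0, by simp⟩)
    (zclosed_singleton 0) fun h => hq0 (h ⟨1, by simp⟩)
  let π := Ideal.Quotient.mk P
  have hπ : Function.Surjective π := Ideal.Quotient.mk_surjective
  have hker : RingHom.ker π = P := Ideal.mk_ker
  have hcm : ∀ J : Ideal (MvPolynomial (Fin n) k), P ≤ J → (J.map π).comap π = J := by
    intro J hJ
    rw [Ideal.comap_map_of_surjective' π hπ, hker]
    exact sup_eq_left.2 hJ
  have hQ' : (Q.map π).IsPrime :=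
    Ideal.map_isPrime_of_surjective hπ (by rw [hker]; exact hPQ.le)
  have hM' : (M.map π).IsPrime :=
    Ideal.map_isPrime_of_surjective hπ (by rw [hker]; exact (hPQ.trans hQM).le)
  have h1 : (⊥ : Ideal (MvPolynomial (Fin n) k ⧸ P)) < Q.map π := by
    rw [bot_lt_iff_ne_bot]
    intro h
    have h' := hcm Q hPQ.le
    rw [h, ← RingHom.ker_eq_comap_bot, hker] at h'
    exact hPQ.ne h'
  have h2 : Q.map π < M.map π := by
    refine lt_of_le_of_ne (Ideal.map_mono hQM.le) fun h => ?_
    have h' := hcm Q hPQ.le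
    rw [h, hcm M (hPQ.trans hQM).le] at h'
    exact hQM.ne h'.symm
  have hmin : M.map π ∈ (Ideal.span {π (linPoly l)}).minimalPrimes := by
    refine ⟨⟨hM', ?_⟩, ?_⟩
    · rw [Ideal.span_singleton_le_iff_mem]
      refine Ideal.mem_map_of_mem _ ?_
      rintro _ rfl
      rw [aeval_linPoly, map_zero]
    · rintro J ⟨hJp, hJ⟩ -
      rw [Ideal.span_singleton_le_iff_mem] at hJ
      rw [Ideal.map_le_iff_le_comap]
      have hJ' : (J.comap π).IsPrime := Ideal.IsPrime.comap _
      rw [← IsPrime.vanishingIdeal_zeroLocus (K := k) (J.comap π)]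
      refine vanishingIdeal_anti_mono fun y hy => ?_
      have hyK : y ∈ K := hcl y fun f hf => hy f (by
        rw [Ideal.mem_comap, Ideal.Quotient.eq_zero_iff_mem.2 hf]
        exact zero_mem _)
      have hyl : l y = 0 := by
        rw [← aeval_linPoly]
        exact hy _ hJ
      by_contra hy0
      exact hcon y hyK hy0 hyl
  have hht := Ideal.height_le_one_of_isPrincipal_of_mem_minimalPrimes _ _ hmin
  have h3 := Ideal.height_add_one_le_of_lt_of_isPrime h1
  have h4 := Ideal.height_add_one_le_of_lt_of_isPrime h2
  have : (2 : ℕ∞) ≤ 1 := by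
    calc (2 : ℕ∞) = 0 + 1 + 1 := by norm_num
      _ ≤ (⊥ : Ideal (MvPolynomial (Fin n) k ⧸ P)).height + 1 + 1 := by gcongr; exact zero_le
      _ ≤ 1 := (add_le_add h3 le_rfl).trans (h4.trans hht)
  exact absurd this (by decide)

theorem inter_linSet_eq {m n : ℕ} {S : Set (PS k n)} {K : Set (Fin m → k)}
    {τ : (Fin m → k) →ₗ[k] (Fin n → k)} (hτ : Function.Injective τ)
    (hS : ∀ y, τ y ∈ cn S ↔ y ∈ K) {W : Submodule k (Fin n → k)} (hW : W ≤ LinearMap.range τ) :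
    S ∩ linSet W =
      Projectivization.map τ hτ '' (pts K ∩ linSet (W.comap τ)) := by
  ext x
  constructor
  · rintro ⟨hxS, hxW⟩
    induction x using Projectivization.ind with
    | h w hw =>
      rw [mk_mem_linSet] at hxW
      obtain ⟨y, rfl⟩ := hW hxW
      have hy0 : y ≠ 0 := by rintro rfl; simp at hw
      exact ⟨Projectivization.mk k y hy0, ⟨⟨y, (hS y).1 ((mem_cn hw).2 hxS), hy0, rfl⟩,
        (mk_mem_linSet hy0).2 hxW⟩, rfl⟩
  · rintro ⟨_, ⟨⟨y, hy, hy0, rfl⟩, hyW⟩, rfl⟩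
    rw [mk_mem_linSet] at hyW
    have hτ0 : τ y ≠ 0 := fun h => hy0 (hτ (by rw [h, map_zero]))
    exact ⟨(hS y).2 hy hτ0, (mk_mem_linSet hτ0).2 hyW⟩

theorem linSet_inf {n : ℕ} (A B : Submodule k (Fin n → k)) :
    linSet (A ⊓ B) = linSet A ∩ linSet B :=
  Set.ext fun x => show x.submodule ≤ A ⊓ B ↔ x.submodule ≤ A ∧ x.submodule ≤ B from le_inf_iff

theorem finrank_comap_of_le_range {m n : ℕ} {τ : (Fin m → k) →ₗ[k] (Fin n → k)}
    (hτ : Function.Injective τ) {W : Submodule k (Fin n → k)} (hW : W ≤ LinearMap.range τ) :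
    Module.finrank k (W.comap τ) = Module.finrank k W := by
  rw [(Submodule.equivMapOfInjective τ hτ (W.comap τ)).finrank_eq,
    Submodule.map_comap_eq_of_le hW]

variable {S : Set (PS k 5)} {v₀ : Fin 5 → k} {p : (Fin 5 → k) →ₗ[k] (Fin 4 → k)}
  {σ : (Fin 4 → k) →ₗ[k] (Fin 5 → k)} {K : Set (Fin 4 → k)}

theorem ConeData.injective (h : ConeData S v₀ p σ K) : Function.Injective σ :=
  Function.LeftInverse.injective h.proj.proj_sec

theorem ConeData.sec_mem (h : ConeData S v₀ p σ K) (y : Fin 4 → k) : σ y ∈ cn S ↔ y ∈ K := by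
  rw [h.mem, h.proj.proj_sec]

theorem ConeData.vertex_mem (h : ConeData S v₀ p σ K) :
    Projectivization.mk k v₀ h.proj.ne ∈ S := by
  rw [← mem_cn, h.mem, h.proj.proj_vertex]
  exact h.zero_mem

theorem ConeData.not_subset_line (h : ConeData S v₀ p σ K) (q : Fin 4 → k) :
    ¬ K ⊆ {w | ∃ t : k, w = t • q} := by
  intro hK
  have h1 : (⊤ : Submodule k (Fin 4 → k)) ≤ Submodule.span k {q} := by
    rw [← h.span, Submodule.span_le]
    intro w hw
    obtain ⟨t, rfl⟩ := hK hw
    exact Submodule.smul_mem _ _ (Submodule.mem_span_singleton_self q)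
  have h2 := Submodule.finrank_mono h1
  rw [finrank_top, Module.finrank_fin_fun] at h2
  have h3 := finrank_span_le_card (R := k) ({q} : Set (Fin 4 → k))
  rw [Set.toFinset_singleton, Finset.card_singleton] at h3
  omega

theorem ConeData.exists_ne_zero (h : ConeData S v₀ p σ K) : ∃ y ∈ K, y ≠ 0 := by
  by_contra! hcon
  exact h.not_subset_line 0 fun w hw => ⟨0, by rw [hcon w hw, smul_zero]⟩

theorem ConeData.exists_vanish [IsAlgClosed k] (h : ConeData S v₀ p σ K)
    (l : (Fin 4 → k) →ₗ[k] k) : ∃ y ∈ K, y ≠ 0 ∧ l y = 0 := by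
  obtain ⟨q, hq, hq0⟩ := h.exists_ne_zero
  exact exists_ne_zero_of_hyperplane h.irr h.zclosed h.cone hq hq0
    (h.not_subset_line q) l

theorem ConeData.infinite_pts (h : ConeData S v₀ p σ K) : (pts K).Infinite := by
  intro hfin
  have hi := isIrreducible_pts h.irr h.exists_ne_zero
  rw [isIrreducible_iff_sUnion_isClosed] at hi
  classical
  obtain ⟨z, hz, hsub⟩ := hi (hfin.toFinset.image fun x => linSet x.submodule)
    (by
      intro z hz
      obtain ⟨x, -, rfl⟩ := Finset.mem_image.1 hz
      exact isClosed_linSet _)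
    (by
      intro x hx
      exact ⟨linSet x.submodule, Finset.mem_coe.2 (Finset.mem_image.2
        ⟨x, hfin.mem_toFinset.2 hx, rfl⟩), le_refl x.submodule⟩)
  obtain ⟨x, -, rfl⟩ := Finset.mem_image.1 hz
  refine h.not_subset_line x.rep fun w hw => ?_
  by_cases hw0 : w = 0
  · exact ⟨0, by rw [hw0, zero_smul]⟩
  · have := hsub ⟨w, hw, hw0, rfl⟩
    rw [mk_mem_linSet, Projectivization.submodule_eq] at this
    obtain ⟨t, ht⟩ := Submodule.mem_span_singleton.1 this
    exact ⟨t, ht.symm⟩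

/-- The numbers of points cut on the projectivization of `K` by planes. -/
def planeCounts (K : Set (Fin 4 → k)) : Set ℕ :=
  {t | ∃ M : Submodule k (Fin 4 → k), Module.finrank k M = 3 ∧
    (pts K ∩ linSet M).Finite ∧ (pts K ∩ linSet M).ncard = t}

theorem mem_planeCounts {τ : (Fin 4 → k) →ₗ[k] (Fin 5 → k)} (hτ : Function.Injective τ)
    (hS : ∀ y, τ y ∈ cn S ↔ y ∈ K) {W : Submodule k (Fin 5 → k)} (hW : W ≤ LinearMap.range τ)
    (hWr : Module.finrank k W = 3) (hfin : (S ∩ linSet W).Finite) :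
    (S ∩ linSet W).ncard ∈ planeCounts K := by
  rw [inter_linSet_eq hτ hS hW] at hfin ⊢
  refine ⟨W.comap τ, by rw [finrank_comap_of_le_range hτ hW, hWr],
    Set.Finite.of_finite_image hfin (Projectivization.map_injective τ hτ).injOn, ?_⟩
  rw [Set.ncard_image_of_injective _ (Projectivization.map_injective τ hτ)]

theorem ConeData.exists_section (h : ConeData S v₀ p σ K) {W : Submodule k (Fin 5 → k)}
    (hW : v₀ ∉ W) : ∃ τ : (Fin 4 → k) →ₗ[k] (Fin 5 → k), Function.Injective τ ∧
      (∀ y, τ y ∈ cn S ↔ y ∈ K) ∧ W ≤ LinearMap.range τ := by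
  obtain ⟨φ, hφ1, hφ2⟩ := Submodule.exists_le_ker_of_notMem hW
  let τ : (Fin 4 → k) →ₗ[k] (Fin 5 → k) := σ - ((φ v₀)⁻¹ • φ.comp σ).smulRight v₀
  have hτ : ∀ y, τ y = σ y - ((φ v₀)⁻¹ * φ (σ y)) • v₀ := fun y => rfl
  have hpτ : ∀ y, p (τ y) = y := by
    intro y
    rw [hτ, map_sub, map_smul, h.proj.proj_vertex, smul_zero, sub_zero, h.proj.proj_sec]
  refine ⟨τ, Function.LeftInverse.injective hpτ, fun y => by rw [h.mem, hpτ], fun w hw => ?_⟩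
  refine ⟨p w, ?_⟩
  obtain ⟨c, hc⟩ := h.proj.decompose w
  have h1 : φ w = 0 := hφ2 hw
  rw [hc, map_add, map_smul, smul_eq_mul] at h1
  have h2 : (φ v₀)⁻¹ * φ (σ (p w)) = -c := by
    rw [eq_neg_of_add_eq_zero_left h1, mul_neg, mul_comm c, inv_mul_cancel_left₀ hφ1]
  rw [hτ, h2, neg_smul, sub_neg_eq_add]
  exact hc.symm

theorem ConeData.degree_surface (h : ConeData S v₀ p σ K) [Infinite k] {t : ℕ}
    (ht : ∃ L : Set (PS k 5), IsLin L (5 - 1 - 2) ∧ (S ∩ L).Finite ∧ (S ∩ L).ncard = t) :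
    t ∈ planeCounts K ∨ t = 1 := by
  obtain ⟨L, ⟨W, hW, rfl⟩, hfin, rfl⟩ := ht
  by_cases hv : v₀ ∈ W
  · right
    rw [Set.ncard_eq_one]
    refine ⟨Projectivization.mk k v₀ h.proj.ne, Set.Subset.antisymm ?_ ?_⟩
    · rintro x ⟨hxS, hxW⟩
      by_contra hne
      induction x using Projectivization.ind with
      | h w hw =>
        rw [mk_mem_linSet] at hxW
        have hli : LinearIndependent k ![w, v₀] := by
          rw [LinearIndependent.pair_iff' hw]
          rintro a rfl
          exact hne (mk_smul h.proj.ne hw).symm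
        have hr : Module.finrank k (Submodule.span k (Set.range ![w, v₀])) = 2 := by
          rw [finrank_span_eq_card hli, Fintype.card_fin]
        refine linSet_infinite (by rw [hr]; norm_num) (hfin.subset (s := _) ?_)
        intro y hy
        induction y using Projectivization.ind with
        | h u hu =>
          rw [mk_mem_linSet, Matrix.range_cons, Matrix.range_cons, Matrix.range_empty,
            Set.union_empty, Set.singleton_union, Submodule.mem_span_pair] at hy
          obtain ⟨a, b, rfl⟩ := hy
          refine ⟨?_, ?_⟩
          · rw [← mem_cn, h.mem, map_add, map_smul, map_smul, h.proj.proj_vertex, smul_zero,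
              add_zero]
            exact h.cone _ ((h.mem w).1 ((mem_cn hw).2 hxS)) a
          · rw [mk_mem_linSet]
            exact add_mem (W.smul_mem _ hxW) (W.smul_mem _ hv)
    · rintro _ rfl
      exact ⟨h.vertex_mem, (mk_mem_linSet _).2 hv⟩
  · left
    obtain ⟨τ, h1, h2, h3⟩ := h.exists_section hv
    exact mem_planeCounts h1 h2 h3 hW hfin

theorem ConeData.degree_curve (h : ConeData S v₀ p σ K) {t : ℕ}
    (ht : ∃ L : Set (PS k 5), IsLin L (5 - 1 - 1) ∧ (S ∩ linSet (LinearMap.range σ) ∩ L).Finite ∧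
      (S ∩ linSet (LinearMap.range σ) ∩ L).ncard = t) : t ∈ planeCounts K := by
  obtain ⟨L, ⟨W, hW, rfl⟩, hfin, rfl⟩ := ht
  rw [Set.inter_assoc, ← linSet_inf] at hfin ⊢
  have hσr : Module.finrank k (LinearMap.range σ) = 4 := by
    rw [LinearMap.finrank_range_of_inj h.injective, Module.finrank_fin_fun]
  by_cases hle : W ≤ LinearMap.range σ
  · exfalso
    have hWe := Submodule.eq_of_le_of_finrank_eq hle (by rw [hW, hσr])
    rw [hWe, inf_idem, inter_linSet_eq h.injective h.sec_mem le_rfl] at hfin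
    have := Set.Finite.of_finite_image hfin (Projectivization.map_injective σ h.injective).injOn
    refine h.infinite_pts (this.subset fun x hx => ⟨hx, ?_⟩)
    intro y hy
    exact ⟨y, rfl⟩
  · refine mem_planeCounts h.injective h.sec_mem inf_le_left ?_ hfin
    have h1 := Submodule.finrank_sup_add_finrank_inf_eq (LinearMap.range σ) W
    have h2 : Module.finrank k (LinearMap.range σ) <
        Module.finrank k ↥(LinearMap.range σ ⊔ W) :=
      Submodule.finrank_lt_finrank_of_lt (left_lt_sup.2 hle)
    have h3 := Submodule.finrank_le (LinearMap.range σ ⊔ W)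
    rw [Module.finrank_fin_fun] at h3
    omega

theorem ConeData.surface_of_planeCounts (h : ConeData S v₀ p σ K) {t : ℕ}
    (ht : t ∈ planeCounts K) :
    ∃ L : Set (PS k 5), IsLin L (5 - 1 - 2) ∧ (S ∩ L).Finite ∧ (S ∩ L).ncard = t := by
  obtain ⟨M, hM, hfin, rfl⟩ := ht
  refine ⟨_, ⟨M.map σ, ?_, rfl⟩, ?_⟩
  · rw [← (Submodule.equivMapOfInjective σ h.injective M).finrank_eq, hM]
  · rw [inter_linSet_eq h.injective h.sec_mem (LinearMap.map_le_range),
      Submodule.comap_map_eq_of_injective h.injective,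
      Set.ncard_image_of_injective _ (Projectivization.map_injective σ h.injective)]
    exact ⟨hfin.image _, rfl⟩

theorem ConeData.curve_of_planeCounts (h : ConeData S v₀ p σ K) {t : ℕ}
    (hv : v₀ ∉ LinearMap.range σ) (ht : t ∈ planeCounts K) :
    ∃ L : Set (PS k 5), IsLin L (5 - 1 - 1) ∧ (S ∩ linSet (LinearMap.range σ) ∩ L).Finite ∧
      (S ∩ linSet (LinearMap.range σ) ∩ L).ncard = t := by
  obtain ⟨M, hM, hfin, rfl⟩ := ht
  refine ⟨_, ⟨M.map σ ⊔ Submodule.span k {v₀}, ?_, rfl⟩, ?_⟩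
  · have h1 := Submodule.finrank_sup_add_finrank_inf_eq (M.map σ) (Submodule.span k {v₀})
    have h2 : M.map σ ⊓ Submodule.span k {v₀} = ⊥ := by
      rw [eq_bot_iff]
      rintro x ⟨hx1, hx2⟩
      obtain ⟨t, rfl⟩ := Submodule.mem_span_singleton.1 hx2
      by_cases ht : t = 0
      · simp [ht]
      · exfalso
        apply hv
        have := (M.map σ).smul_mem t⁻¹ hx1
        rw [smul_smul, inv_mul_cancel₀ ht, one_smul] at this
        exact LinearMap.map_le_range this
    rw [h2, finrank_bot, finrank_span_singleton h.proj.ne,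
      ← (Submodule.equivMapOfInjective σ h.injective M).finrank_eq, hM] at h1
    omega
  · have hc : (LinearMap.range σ ⊓ (M.map σ ⊔ Submodule.span k {v₀})).comap σ = M := by
      ext y
      constructor
      · rintro ⟨-, hy⟩
        obtain ⟨_, ⟨m, hm, rfl⟩, b, hb, hab⟩ := Submodule.mem_sup.1 hy
        obtain ⟨t, rfl⟩ := Submodule.mem_span_singleton.1 hb
        have := congrArg p hab
        rw [map_add, map_smul, h.proj.proj_vertex, smul_zero, add_zero, h.proj.proj_sec,
          h.proj.proj_sec] at this
        exact this ▸ hm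
      · intro hy
        exact ⟨⟨y, rfl⟩, Submodule.mem_sup_left ⟨y, hy, rfl⟩⟩
    rw [Set.inter_assoc, ← linSet_inf, inter_linSet_eq h.injective h.sec_mem inf_le_left, hc,
      Set.ncard_image_of_injective _ (Projectivization.map_injective σ h.injective)]
    exact ⟨hfin.image _, rfl⟩

theorem ConeData.one_le_of_mem_planeCounts [IsAlgClosed k] (h : ConeData S v₀ p σ K) {t : ℕ}
    (ht : t ∈ planeCounts K) : 1 ≤ t := by
  obtain ⟨M, hM, hfin, rfl⟩ := ht
  rw [Nat.one_le_iff_ne_zero, Ne, Set.ncard_eq_zero hfin, ← Ne, ← Set.nonempty_iff_ne_empty]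
  have hMt : ∃ w, w ∉ M := by
    by_contra! hcon
    have : M = ⊤ := Submodule.eq_top_iff'.2 hcon
    rw [this, finrank_top, Module.finrank_fin_fun] at hM
    omega
  obtain ⟨w, hw⟩ := hMt
  obtain ⟨l, hl1, hl2⟩ := Submodule.exists_le_ker_of_notMem hw
  have hker : M = LinearMap.ker l := by
    refine Submodule.eq_of_le_of_finrank_le hl2 ?_
    have h1 : LinearMap.ker l ≠ ⊤ := by
      intro h
      exact hl1 (by have : w ∈ LinearMap.ker l := h ▸ Submodule.mem_top
                    exact this)
    have := Submodule.finrank_lt h1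
    rw [Module.finrank_fin_fun] at this
    omega
  obtain ⟨y, hy, hy0, hyl⟩ := h.exists_vanish l
  exact ⟨_, ⟨y, hy, hy0, rfl⟩, (mk_mem_linSet hy0).2 (hker ▸ hyl)⟩

theorem ConeData.degree_eq [IsAlgClosed k] (h : ConeData S v₀ p σ K)
    (hv : v₀ ∉ LinearMap.range σ) {d d' : ℕ} (hd : HasDegree S 2 d)
    (hd' : HasDegree (S ∩ linSet (LinearMap.range σ)) 1 d') : d' = d ∧ 1 ≤ d := by
  have : Infinite k := IsAlgClosed.instInfinite
  have h1 := h.degree_curve hd'.1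
  have h2 := h.one_le_of_mem_planeCounts h1
  have h3 : d' ≤ d := hd.2 (h.surface_of_planeCounts h1)
  have h4 : d ≤ d' := by
    rcases h.degree_surface hd.1 with h4 | rfl
    · exact hd'.2 (h.curve_of_planeCounts hv h4)
    · exact h2
  omega

theorem ConeData.ne_univ [IsAlgClosed k] (h : ConeData S v₀ p σ K) {d : ℕ}
    (hd : HasDegree S 2 d) : K ≠ Set.univ := by
  have : Infinite k := IsAlgClosed.instInfinite
  intro hK
  obtain ⟨L, ⟨W, hW, rfl⟩, hfin, -⟩ := hd.1
  refine linSet_infinite (W := W) (by omega) (hfin.subset fun x hx => ⟨?_, hx⟩)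
  induction x using Projectivization.ind with
  | h w hw =>
    rw [← mem_cn, h.mem, hK]
    trivial

end Degree

section Entry

open EL

variable {k : Type} [Field k]

/-- Composition of a polynomial with a linear map. -/
def compLin {m n : ℕ} (p : (Fin m → k) →ₗ[k] (Fin n → k)) (f : MvPolynomial (Fin n) k) :
    MvPolynomial (Fin m) k :=
  bind₁ (fun i => linPoly ((LinearMap.proj i).comp p)) f

theorem aeval_compLin {m n : ℕ} (p : (Fin m → k) →ₗ[k] (Fin n → k)) (f : MvPolynomial (Fin n) k)
    (w : Fin m → k) : aeval w (compLin p f) = aeval (p w) f := by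
  rw [compLin, aeval_bind₁]
  congr 1
  congr 1
  funext i
  rw [aeval_linPoly]
  rfl

theorem exists_aeval_ne_zero [Infinite k] {n : ℕ} {f : MvPolynomial (Fin n) k} (hf : f ≠ 0) :
    ∃ w : Fin n → k, aeval w f ≠ 0 := by
  by_contra! hcon
  exact hf (MvPolynomial.funext fun x => by rw [map_zero]; exact hcon x)

theorem ne_zero_of_aeval {n : ℕ} {f : MvPolynomial (Fin n) k} {w : Fin n → k}
    (h : aeval w f ≠ 0) : f ≠ 0 := by
  rintro rfl
  exact h (map_zero _)

theorem ncard_summands {n : ℕ} {S : Set (PS k n)} {w : Fin n → k} (hw : w ≠ 0)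
    (hq : Projectivization.mk k w hw ∉ S) (hfin : (summands S w).Finite)
    (hne : (summands S w).Nonempty)
    (hprop : ∀ a ∈ summands S w, ∀ t : k, t • a ∈ summands S w → t • a = a) :
    (summands S w).ncard = 2 * (decomps S (Projectivization.mk k w hw)).ncard := by
  classical
  let φ : (Fin n → k) → Finset (PS k n) := fun a =>
    if h : a ≠ 0 ∧ w - a ≠ 0 then
      {Projectivization.mk k a h.1, Projectivization.mk k (w - a) h.2} else ∅
  have hφ : ∀ (a : Fin n → k) (h1 : a ≠ 0) (h2 : w - a ≠ 0), φ a =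
      {Projectivization.mk k a h1, Projectivization.mk k (w - a) h2} :=
    fun a h1 h2 => dif_pos ⟨h1, h2⟩
  have hd : decomps S (Projectivization.mk k w hw) = ↑(hfin.toFinset.image φ) := by
    rw [decomps_eq hw hq hne, Finset.coe_image, hfin.coe_toFinset]
    ext A
    constructor
    · rintro ⟨a, ha, h1, h2, rfl⟩
      exact ⟨a, ha, hφ a h1 h2⟩
    · rintro ⟨a, ha, rfl⟩
      obtain ⟨h1, h2, -⟩ := summands_ne hw hq ha
      exact ⟨a, ha, h1, h2, hφ a h1 h2⟩
  rw [hd, Set.ncard_coe_finset, Set.ncard_eq_toFinset_card _ hfin,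
    Finset.card_eq_sum_card_image φ, Finset.sum_const_nat (m := 2), mul_comm]
  intro b hb
  obtain ⟨a, ha, rfl⟩ := Finset.mem_image.1 hb
  rw [hfin.mem_toFinset] at ha
  obtain ⟨h1, h2, h3⟩ := summands_ne hw hq ha
  have ha' : w - a ∈ summands S w := ⟨ha.2, by rw [sub_sub_cancel]; exact ha.1⟩
  have hsub : w - (w - a) ≠ 0 := by rwa [sub_sub_cancel]
  have hpair : φ (w - a) = φ a := by
    rw [hφ _ h2 hsub, hφ _ h1 h2, Finset.pair_comm]
    congr 2
    rw [sub_sub_cancel]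
  have hneq : a ≠ w - a := by
    intro h
    apply h3
    congr 1
  have hfib : hfin.toFinset.filter (fun x => φ x = φ a) = {a, w - a} := by
    ext x
    rw [Finset.mem_filter, hfin.mem_toFinset, Finset.mem_insert, Finset.mem_singleton]
    constructor
    · rintro ⟨hx, hxa⟩
      obtain ⟨g1, g2, -⟩ := summands_ne hw hq hx
      have hmem : Projectivization.mk k x g1 ∈ φ a := by
        rw [← hxa, hφ x g1 g2]
        exact Finset.mem_insert_self _ _
      rw [hφ a h1 h2, Finset.mem_insert, Finset.mem_singleton] at hmem
      rcases hmem with h | h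
      · obtain ⟨t, ht⟩ := (Projectivization.mk_eq_mk_iff' k _ _ _ _).1 h
        left
        rw [← ht]
        exact hprop a ha t (ht ▸ hx)
      · obtain ⟨t, ht⟩ := (Projectivization.mk_eq_mk_iff' k _ _ _ _).1 h
        right
        rw [← ht]
        exact hprop _ ha' t (ht ▸ hx)
    · rintro (rfl | rfl)
      · exact ⟨ha, rfl⟩
      · exact ⟨ha', hpair⟩
  rw [hfib, Finset.card_pair hneq]

variable {v₀ : Fin 5 → k} {p : (Fin 5 → k) →ₗ[k] (Fin 4 → k)}
  {σ : (Fin 4 → k) →ₗ[k] (Fin 5 → k)}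

/-- The line of the cone with vertex `v₀` over the point `a` of the base. -/
def ruling (v₀ : Fin 5 → k) (σ : (Fin 4 → k) →ₗ[k] (Fin 5 → k)) (a : Fin 4 → k) :
    Set (PS k 5) := linSet (Submodule.span k {σ a, v₀})

theorem mk_mem_ruling (h : ProjData v₀ p σ) {a : Fin 4 → k} {w : Fin 5 → k} (hw : w ≠ 0) :
    Projectivization.mk k w hw ∈ ruling v₀ σ a ↔ ∃ t : k, p w = t • a := by
  rw [ruling, mk_mem_linSet, Submodule.mem_span_pair]
  constructor
  · rintro ⟨s, t, rfl⟩
    exact ⟨s, by rw [map_add, map_smul, map_smul, h.proj_sec, h.proj_vertex, smul_zero, add_zero]⟩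
  · rintro ⟨t, ht⟩
    obtain ⟨c, hc⟩ := h.decompose w
    exact ⟨t, c, by rw [← map_smul, ← ht, ← hc]⟩

theorem sec_ne_zero (h : ProjData v₀ p σ) {a : Fin 4 → k} (ha : a ≠ 0) : σ a ≠ 0 := fun h0 =>
  ha (by rw [← h.proj_sec a, h0, map_zero])

theorem isLin_ruling (h : ProjData v₀ p σ) {a : Fin 4 → k} (ha : a ≠ 0) :
    IsLin (ruling v₀ σ a) 1 := by
  refine ⟨_, ?_, rfl⟩
  have hli : LinearIndependent k ![σ a, v₀] := by
    rw [LinearIndependent.pair_iff' (sec_ne_zero h ha)]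
    rintro t ht
    have h1 := congrArg p ht
    rw [map_smul, h.proj_sec, h.proj_vertex] at h1
    rcases smul_eq_zero.1 h1 with rfl | h1
    · exact h.ne (by rw [← ht, zero_smul])
    · exact ha h1
  have hr := finrank_span_eq_card hli
  rw [Matrix.range_cons, Matrix.range_cons, Matrix.range_empty, Set.union_empty,
    Set.singleton_union, Fintype.card_fin] at hr
  exact hr

theorem vertex_mem_ruling (h : ProjData v₀ p σ) (a : Fin 4 → k) :
    Projectivization.mk k v₀ h.ne ∈ ruling v₀ σ a :=
  (mk_mem_ruling h h.ne).2 ⟨0, by rw [h.proj_vertex, zero_smul]⟩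

theorem mem_ruling_self (h : ProjData v₀ p σ) {a : Fin 4 → k} (ha : a ≠ 0) :
    Projectivization.mk k (σ a) (sec_ne_zero h ha) ∈ ruling v₀ σ a :=
  (mk_mem_ruling h _).2 ⟨1, by rw [h.proj_sec, one_smul]⟩

theorem closure_pts_preimage [Infinite k] (h : ProjData v₀ p σ) {A : Set (Fin 4 → k)}
    (hfin : A.Finite) (h0 : ∀ a ∈ A, a ≠ 0) :
    closure (pts (p ⁻¹' A)) = ⋃ a ∈ A, ruling v₀ σ a := by
  refine Set.Subset.antisymm (closure_minimal ?_ ?_) ?_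
  · rintro _ ⟨w, hw, hw0, rfl⟩
    exact Set.mem_biUnion hw ((mk_mem_ruling h hw0).2 ⟨1, by rw [one_smul]⟩)
  · exact hfin.isClosed_biUnion fun a _ => isClosed_linSet _
  · have hmem : ∀ a ∈ A, ∀ (w : Fin 5 → k) (hw : w ≠ 0) (t : k), t ≠ 0 → p w = t • a →
        Projectivization.mk k w hw ∈ pts (p ⁻¹' A) := by
      intro a ha w hw t ht hpw
      have hu : t⁻¹ • w ≠ 0 := smul_ne_zero (inv_ne_zero ht) hw
      refine ⟨_, ?_, hu, (mk_smul hu hw).symm⟩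
      rw [Set.mem_preimage, map_smul, hpw, smul_smul, inv_mul_cancel₀ ht, one_smul]
      exact ha
    intro x hx
    obtain ⟨a, ha, hxa⟩ := Set.mem_iUnion₂.1 hx
    induction x using Projectivization.ind with
    | h w hw =>
      obtain ⟨t, ht⟩ := (mk_mem_ruling h hw).1 hxa
      by_contra hcl
      obtain ⟨d, f, -, hf1, hf2⟩ := exists_poly_of_notMem_closure hw hcl
      obtain ⟨j, hj⟩ := Function.ne_iff.1 (h0 a ha)
      obtain ⟨y, ⟨s, hs⟩, hy1, hy2⟩ := (irr_iff.1 (irr_preimage h (irr_line a))).2 f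
        (linPoly ((LinearMap.proj j).comp p)) ⟨w, ⟨t, ht⟩, hf1⟩
        ⟨σ a, ⟨1, by rw [h.proj_sec, one_smul]⟩, by
          rw [aeval_linPoly, LinearMap.comp_apply, h.proj_sec]; exact hj⟩
      rw [aeval_linPoly, LinearMap.comp_apply, hs] at hy2
      have hs0 : s ≠ 0 := by
        rintro rfl
        exact hy2 (by rw [zero_smul, map_zero])
      have hy0 : y ≠ 0 := by
        rintro rfl
        exact hy2 (by rw [← hs, map_zero, map_zero])
      exact hy1 (hf2 y ((mem_cn hy0).2 (hmem a ha y hy0 s hs0 hs)))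

open Classical in
theorem rulings_card (h : ProjData v₀ p σ) {A : Finset (Fin 4 → k)} (h0 : ∀ a ∈ A, a ≠ 0)
    (hprop : ∀ a ∈ A, ∀ t : k, t • a ∈ A → t • a = a) :
    (A.image (ruling v₀ σ)).card = A.card := by
  refine Finset.card_image_of_injOn fun b hb a ha hab => ?_
  have hm := mem_ruling_self h (h0 b hb)
  rw [show ruling v₀ σ b = ruling v₀ σ a from hab, mk_mem_ruling h, h.proj_sec] at hm
  obtain ⟨t, rfl⟩ := hm
  exact hprop a ha t hb

theorem not_isIrreducible_rulings (h : ProjData v₀ p σ) {A : Set (Fin 4 → k)} (hfin : A.Finite)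
    (h0 : ∀ a ∈ A, a ≠ 0) (hprop : ∀ a ∈ A, ∀ t : k, t • a ∈ A → t • a = a)
    (hA : 1 < A.ncard) : ¬ IsIrreducible (⋃ a ∈ A, ruling v₀ σ a) := by
  classical
  intro hi
  rw [isIrreducible_iff_sUnion_isClosed] at hi
  obtain ⟨z, hz, hsub⟩ := hi (hfin.toFinset.image (ruling v₀ σ))
    (by
      intro z hz
      obtain ⟨x, -, rfl⟩ := Finset.mem_image.1 hz
      exact isClosed_linSet _)
    (by
      intro x hx
      obtain ⟨a, ha, hxa⟩ := Set.mem_iUnion₂.1 hx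
      exact ⟨_, Finset.mem_coe.2 (Finset.mem_image.2 ⟨a, hfin.mem_toFinset.2 ha, rfl⟩), hxa⟩)
  obtain ⟨a, ha, rfl⟩ := Finset.mem_image.1 hz
  rw [hfin.mem_toFinset] at ha
  obtain ⟨b, hb, hba⟩ := Set.exists_ne_of_one_lt_ncard hA a
  have hm := hsub (Set.mem_biUnion hb (mem_ruling_self h (h0 b hb)))
  rw [mk_mem_ruling h, h.proj_sec] at hm
  obtain ⟨t, rfl⟩ := hm
  exact hba (hprop a ha t hb)

end Entry

section Assembly

open EL

variable {k : Type} [Field k]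

theorem mem_cn_inter_linSet {n : ℕ} {S : Set (PS k n)} {W : Submodule k (Fin n → k)}
    {w : Fin n → k} : w ∈ cn (S ∩ linSet W) ↔ w ∈ cn S ∧ w ∈ W := by
  by_cases hw : w = 0
  · subst hw
    exact ⟨fun _ => ⟨zero_mem_cn _, W.zero_mem⟩, fun _ => zero_mem_cn _⟩
  · rw [mem_cn hw, mem_cn hw, Set.mem_inter_iff, mk_mem_linSet]

variable {S : Set (PS k 5)} {v₀ : Fin 5 → k} {p : (Fin 5 → k) →ₗ[k] (Fin 4 → k)}
  {σ : (Fin 4 → k) →ₗ[k] (Fin 5 → k)} {K : Set (Fin 4 → k)}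

theorem ConeData.summands_surface (h : ConeData S v₀ p σ K) (w : Fin 5 → k) :
    summands S w = p ⁻¹' {a | a ∈ K ∧ p w - a ∈ K} := by
  ext a
  rw [summands, Set.mem_ofPred_eq, h.mem, h.mem, map_sub]
  rfl

theorem ConeData.summands_curve (h : ConeData S v₀ p σ K) (y : Fin 4 → k) :
    summands (S ∩ linSet (LinearMap.range σ)) (σ y) = σ '' {a | a ∈ K ∧ y - a ∈ K} := by
  ext a
  rw [summands, Set.mem_ofPred_eq, mem_cn_inter_linSet, mem_cn_inter_linSet]
  constructor
  · rintro ⟨⟨h1, ⟨a, rfl⟩⟩, h2, -⟩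
    rw [← map_sub, h.sec_mem] at h2
    exact ⟨a, ⟨(h.sec_mem a).1 h1, h2⟩, rfl⟩
  · rintro ⟨a, ⟨h1, h2⟩, rfl⟩
    rw [← map_sub, h.sec_mem, h.sec_mem]
    exact ⟨⟨h1, ⟨a, rfl⟩⟩, h2, ⟨_, rfl⟩⟩

theorem ConeData.pspan_curve (h : ConeData S v₀ p σ K) :
    pspan (S ∩ linSet (LinearMap.range σ)) = LinearMap.range σ := by
  refine le_antisymm (iSup₂_le fun x hx => hx.2) ?_
  have hspan : LinearMap.range σ = Submodule.span k (σ '' K) := by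
    rw [LinearMap.range_eq_map, ← h.span, Submodule.map_span]
  refine hspan.trans_le (Submodule.span_le.2 ?_)
  rintro _ ⟨y, hy, rfl⟩
  by_cases hy0 : y = 0
  · rw [hy0, map_zero]
    exact Submodule.zero_mem _
  · have hσ := sec_ne_zero h.proj hy0
    have hC : Projectivization.mk k (σ y) hσ ∈ S ∩ linSet (LinearMap.range σ) :=
      ⟨(mem_cn hσ).1 ((h.sec_mem y).2 hy), (mk_mem_linSet hσ).2 ⟨y, rfl⟩⟩
    refine (le_iSup₂ (f := fun (x : PS k 5) (_ : x ∈ S ∩ linSet (LinearMap.range σ)) =>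
      x.submodule) _ hC) ?_
    rw [Projectivization.submodule_mk]
    exact Submodule.mem_span_singleton_self _

theorem ConeData.exists_vanishing_poly (h : ConeData S v₀ p σ K) (hne : K ≠ Set.univ) :
    ∃ f : MvPolynomial (Fin 4) k, f ≠ 0 ∧ ∀ y, aeval y f ≠ 0 → y ∉ K := by
  obtain ⟨y, hy⟩ := (Set.ne_univ_iff_exists_notMem K).1 hne
  by_contra! hcon
  refine hy (h.zclosed y fun f hf => ?_)
  by_contra hfy
  obtain ⟨z, hz, hzK⟩ := hcon f (ne_zero_of_aeval hfy)
  exact hz (hf z hzK)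

theorem ConeData.generic_entryLocus [IsAlgClosed k] [CharZero k] (h : ConeData S v₀ p σ K)
    (hS : IsClosed S) (hdim : pdim S = 2) (hv : v₀ ∉ LinearMap.range σ) {d g : ℕ}
    (hd : HasDegree S 2 d) (hg : HasGenus (S ∩ linSet (LinearMap.range σ)) g) :
    Generic (fun q : PS k 5 =>
      (∃ (𝔏 : Finset (Set (PS k 5))) (c : ℕ),
        c + 2 * g = (d - 1) * (d - 2) ∧ 𝔏.card = c ∧
        (∀ L ∈ 𝔏, IsLin L 1 ∧ Projectivization.mk k v₀ h.proj.ne ∈ L) ∧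
        entryLocus S q = ⋃₀ (↑𝔏 : Set (Set (PS k 5)))) ∧
      ¬ IsIrreducible (entryLocus S q)) := by
  classical
  have : Infinite k := IsAlgClosed.instInfinite
  have hr := rkLE_base h.proj hS hdim.le h.mem h.irr h.zclosed h.cone h.exists_ne_zero
  have hne := h.ne_univ hd
  obtain ⟨d', hd', hgen⟩ := hg
  obtain ⟨rfl, hd1⟩ := h.degree_eq hv hd hd'
  rw [h.pspan_curve] at hgen
  have hbot : LinearMap.range σ ≠ ⊥ := by
    obtain ⟨y, -, hy⟩ := h.exists_ne_zero
    intro hb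
    exact sec_ne_zero h.proj hy ((Submodule.mem_bot k).1 (hb ▸ ⟨y, rfl⟩))
  obtain ⟨f₀, ⟨_, ⟨y₀, rfl⟩, hy₀⟩, hf₀⟩ := exists_poly_of_genericIn hbot hgen
  obtain ⟨f₁, hf₁, hfib⟩ := finite_add_fibres h.irr h.zclosed h.zero_mem h.cone h.span hne hr
  obtain ⟨f₂, hf₂, htri⟩ := no_trisecant h.cone hr
  obtain ⟨f₃, hf₃, hvan⟩ := h.exists_vanishing_poly hne
  have hf₀' : compLin σ f₀ ≠ 0 := ne_zero_of_aeval (w := y₀) (by rwa [aeval_compLin])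
  obtain ⟨y₁, hy₁⟩ := exists_aeval_ne_zero
    (mul_ne_zero (mul_ne_zero hf₀' hf₁) (mul_ne_zero hf₂ hf₃))
  refine generic_of_poly (F := compLin p (compLin σ f₀ * f₁ * (f₂ * f₃)))
    (ne_zero_of_aeval (w := σ y₁) (by rwa [aeval_compLin, h.proj.proj_sec])) fun w hw hF => ?_
  rw [aeval_compLin, map_mul, map_mul, map_mul, aeval_compLin] at hF
  have hF₀ := left_ne_zero_of_mul (left_ne_zero_of_mul hF)
  have hF₁ := right_ne_zero_of_mul (left_ne_zero_of_mul hF)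
  have hF₂ := left_ne_zero_of_mul (right_ne_zero_of_mul hF)
  have hK : p w ∉ K := hvan _ (right_ne_zero_of_mul (right_ne_zero_of_mul hF))
  obtain ⟨hfin, hnon⟩ := hfib _ hF₁
  have hp0 : p w ≠ 0 := fun h0 => hK (h0 ▸ h.zero_mem)
  have hσ0 := sec_ne_zero h.proj hp0
  set A : Set (Fin 4 → k) := {a | a ∈ K ∧ p w - a ∈ K} with hA
  have hA0 : ∀ a ∈ A, a ≠ 0 := by
    rintro a ha rfl
    exact hK (by have := ha.2; rwa [sub_zero] at this)
  have hprop : ∀ a ∈ A, ∀ t : k, t • a ∈ A → t • a = a := by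
    intro a ha t hta
    by_contra hne
    have ht : 1 - t ≠ 0 := by
      intro h0
      rw [sub_eq_zero] at h0
      exact hne (by rw [← h0, one_smul])
    refine htri a ha.1 (p w - a) ha.2 (1 - t) ht (by rwa [add_sub_cancel]) ?_
    have e : p w - a + (1 - t) • a = p w - t • a := by
      rw [sub_smul, one_smul]; abel
    rw [e]
    exact hta.2
  have hqS : Projectivization.mk k w hw ∉ S := fun hq => hK ((h.mem w).1 ((mem_cn hw).2 hq))
  have hqC : Projectivization.mk k (σ (p w)) hσ0 ∉ S ∩ linSet (LinearMap.range σ) := fun hq =>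
    hK ((h.sec_mem _).1 ((mem_cn hσ0).2 hq.1))
  have hcard : A.ncard = 2 * (decomps (S ∩ linSet (LinearMap.range σ))
      (Projectivization.mk k (σ (p w)) hσ0)).ncard := by
    rw [← Set.ncard_image_of_injective A h.injective, hA, ← h.summands_curve]
    refine ncard_summands hσ0 hqC ?_ ?_ ?_
    · rw [h.summands_curve]; exact hfin.image _
    · rw [h.summands_curve]; exact hnon.image _
    · rw [h.summands_curve]
      rintro _ ⟨a, ha, rfl⟩ t ⟨b, hb, hab⟩
      rw [← map_smul] at hab
      obtain rfl := h.injective hab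
      rw [← map_smul, hprop a ha t hb]
  have hcount := hf₀ _ ⟨p w, rfl⟩ hσ0 hF₀
  have hpos : 0 < A.ncard := (Set.ncard_pos hfin).2 hnon
  have hlocus : entryLocus S (Projectivization.mk k w hw) = ⋃ a ∈ A, ruling v₀ σ a := by
    rw [entryLocus_eq hw hqS, h.summands_surface, closure_pts_preimage h.proj hfin hA0]
    rw [h.summands_surface]
    obtain ⟨a, ha⟩ := hnon
    exact ⟨σ a, by rw [Set.mem_preimage, h.proj.proj_sec]; exact ha⟩
  rw [hlocus]
  refine ⟨⟨hfin.toFinset.image (ruling v₀ σ), A.ncard, ?_, ?_, ?_, ?_⟩,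
    not_isIrreducible_rulings h.proj hfin hA0 hprop (by omega)⟩
  · rw [hcard]
    obtain ⟨e, rfl⟩ := Nat.exists_eq_add_of_le hd1
    rcases e with _ | e
    · omega
    · have h1 : 1 + (e + 1) - 1 = e + 1 := by omega
      have h2 : 1 + (e + 1) - 2 = e := by omega
      rw [h1, h2]
      nlinarith
  · rw [rulings_card h.proj (by simpa using hA0), Set.ncard_eq_toFinset_card A hfin]
    intro a ha t hta
    rw [hfin.mem_toFinset] at ha hta
    exact hprop a ha t hta
  · intro L hL
    obtain ⟨a, ha, rfl⟩ := Finset.mem_image.1 hL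
    exact ⟨isLin_ruling h.proj (hA0 a (hfin.mem_toFinset.1 ha)), vertex_mem_ruling h.proj a⟩
  · rw [Finset.coe_image, hfin.coe_toFinset, Set.sUnion_image]

end Assembly

end ConeSec

open EL in
/-- For an integral normal nondegenerate surface `X ⊂ ℙ^4` of degree `d`
which is a cone with vertex `v`, with `g` the genus of a general hyperplane section
avoiding `v`, the general entry locus is the union of `(d-1)(d-2) - 2g` lines through
`v`; in particular it is reducible. -/
theorem statement13 {k : Type} [Field k] [IsAlgClosed k] [CharZero k]
    (d g : ℕ) (X : Set (PS k 5)) (hX : IsVariety X) (hnd : Nondeg X)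
    (hdim : pdim X = 2) (hnorm : IsNormalVar X)
    (v : PS k 5) (hcone : IsCone X v) (hdeg : HasDegree X 2 d)
    (hg : Generic (fun a : PS k 5 => v ∉ hypOf a ∧ HasGenus (X ∩ hypOf a) g)) :
    Generic (fun q : PS k 5 =>
      (∃ (𝔏 : Finset (Set (PS k 5))) (c : ℕ),
        c + 2 * g = (d - 1) * (d - 2) ∧ 𝔏.card = c ∧
        (∀ L ∈ 𝔏, IsLin L 1 ∧ v ∈ L) ∧
        entryLocus X q = ⋃₀ (↑𝔏 : Set (Set (PS k 5)))) ∧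
      ¬ IsIrreducible (entryLocus X q)) := by
  have : Infinite k := IsAlgClosed.instInfinite
  obtain ⟨U, -, hU, hP⟩ := hg
  have : Nonempty (PS k 5) := ⟨v⟩
  obtain ⟨a, ha⟩ := hU.nonempty
  obtain ⟨hva, hga⟩ := hP a ha
  have hv : v.rep ∉ hypSub a := fun h => hva (by
    rw [hypOf, ← v.mk_rep, ConeSec.mk_mem_linSet]; exact h)
  obtain ⟨p, σ, hproj, hrange⟩ := ConeSec.exists_projData _ hv
  have hr : hypSub a = LinearMap.range σ := hrange.symm
  rw [hypOf, hr] at hga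
  rw [hr] at hv
  have h := ConeSec.coneData_of_isCone hX hnd hcone hproj
  have key := h.generic_entryLocus hX.1 hdim hv hdeg hga
  simp only [v.mk_rep] at key
  exact key
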